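/- For a ∈ (1/4,1/2): φ(a) = χ(a) if and only if a ∈ 𝒮; moreover, for every a ∈ 𝒮 one has φ(a) = χ(a) = a + 1/4. -/

import Mathlib

noncomputable section

/-- The doubling map. -/
def Dbl (x : ℝ) : ℝ := if x ≤ 1/2 then 2*x else 2*x - 1

/-- Survivor set `𝒥(a,b)`. -/
def J (a b : ℝ) : Set ℝ := {x ∈ Set.Icc (0:ℝ) 1 | ∀ n : ℕ, Dbl^[n] x ∉ Set.Ioo a b}

/-- The shift on binary sequences. -/
def shft (x : ℕ → Bool) : ℕ → Bool := fun n => x (n+1)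

/-- Binary expansion value. -/
def piMap (w : ℕ → Bool) : ℝ := ∑' n : ℕ, (if w n then (1:ℝ) else 0) / 2 ^ (n+1)

/-- Strict lexicographic order on binary sequences. -/
def seqLt (u v : ℕ → Bool) : Prop := ∃ n, (∀ i < n, u i = v i) ∧ u n < v n

def seqLe (u v : ℕ → Bool) : Prop := seqLt u v ∨ u = v

/-- Periodic sequence `w^∞` associated with a finite word. -/
def per (w : List Bool) : ℕ → Bool := fun n => w.getD (n % w.length) false

/-- Concatenation of a finite word and an infinite sequence. -/
def cat (w : List Bool) (x : ℕ → Bool) : ℕ → Bool :=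
  fun n => if n < w.length then w.getD n false else x (n - w.length)

/-- A finite word is balanced. -/
def BalancedWord (l : List Bool) : Prop :=
  ∀ u v : List Bool, u <:+: l → v <:+: l → u.length = v.length →
    (u.count true : ℤ) - (v.count true : ℤ) ≤ 1

/-- A finite word is cyclically balanced. -/
def CycBalanced (w : List Bool) : Prop := BalancedWord (w ++ w)

def OmegaSet (r : ℚ) (b : Bool) : Set (List Bool) :=
  {w | w.length = r.den ∧ w.count true = r.num.toNat ∧ CycBalanced w ∧ w.head? = some b}

/-- `w` is the lexicographically largest cyclically balanced word of length `q`
with `p` ones beginning with 0, where `r = p/q` in lowest terms. -/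
def IsOmegaMinus (r : ℚ) (w : List Bool) : Prop :=
  w ∈ OmegaSet r false ∧ ∀ v ∈ OmegaSet r false, v = w ∨ List.Lex (· < ·) v w

/-- `w` is the lexicographically smallest cyclically balanced word of length `q`
with `p` ones beginning with 1. -/
def IsOmegaPlus (r : ℚ) (w : List Bool) : Prop :=
  w ∈ OmegaSet r true ∧ ∀ v ∈ OmegaSet r true, v = w ∨ List.Lex (· < ·) w v

open Classical in
def omegaMinus (r : ℚ) : List Bool :=
  if h : ∃ w, IsOmegaMinus r w then h.choose else []

open Classical in
def omegaPlus (r : ℚ) : List Bool :=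
  if h : ∃ w, IsOmegaPlus r w then h.choose else []

/-- The substitution `ρ_r` applied to a word. -/
def substR (r : ℚ) (w : List Bool) : List Bool :=
  (w.map (fun b => if b then omegaPlus r else omegaMinus r)).flatten

/-- `s_n = ρ_{r_1}∘⋯∘ρ_{r_n}(0)`. -/
def sWord : List ℚ → List Bool
  | [] => [false]
  | r :: rs => substR r (sWord rs)

/-- `t_n = ρ_{r_1}∘⋯∘ρ_{r_n}(1)`. -/
def tWord : List ℚ → List Bool
  | [] => [true]
  | r :: rs => substR r (tWord rs)

/-- `Δ(r_1,…,r_n) = [π(s_n^∞), π(s_n t_n^∞)]`. -/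
def DeltaI (rs : List ℚ) : Set ℝ :=
  Set.Icc (piMap (per (sWord rs))) (piMap (cat (sWord rs) (per (tWord rs))))

/-- `Δ̃(r_1,…,r_n) = [π(s_n t_n s_n^∞), π(s_n t_n^∞)]`. -/
def DeltaTilde (rs : List ℚ) : Set ℝ :=
  Set.Icc (piMap (cat (sWord rs) (cat (tWord rs) (per (sWord rs)))))
    (piMap (cat (sWord rs) (per (tWord rs))))

/-- The exceptional set `𝒮`. -/
def Scal : Set ℝ :=
  Set.Ioo (1/4 : ℝ) (1/2) \ ⋃ r ∈ {r : ℚ | 0 < r ∧ r < 1}, DeltaI [r]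

/-- `φ(a)`. -/
def phi (a : ℝ) : ℝ := sSup {b | b ∈ Set.Ioo a 1 ∧ J a b ≠ ({0, 1} : Set ℝ)}

/-- `χ(a)`. -/
def chi (a : ℝ) : ℝ := sSup {b | b ∈ Set.Ioo a 1 ∧ ¬ (J a b).Countable}

/-- `s_n` built from the first `m` entries of an infinite sequence of rationals. -/
def sWordN (r : ℕ → ℚ) (m : ℕ) : List Bool := sWord (List.ofFn fun i : Fin m => r i)

def tWordN (r : ℕ → ℚ) (m : ℕ) : List Bool := tWord (List.ofFn fun i : Fin m => r i)

/-- `𝔰(𝐫)`, the coordinatewise limit of `ρ_{r_1}⋯ρ_{r_n}(0)`. -/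
def sLim (r : ℕ → ℚ) : ℕ → Bool := fun k => (sWordN r (k+1)).getD k false

/-- `𝔱(𝐫)`. -/
def tLim (r : ℕ → ℚ) : ℕ → Bool := fun k => (tWordN r (k+1)).getD k false


/-! ### Part 1: analytic functions -/

def Xf (g t : ℝ) : ℝ := ∑' n : ℕ, (⌊(n:ℝ) * g + t⌋ : ℝ) / 2 ^ (n+1)
def Xc (g t : ℝ) : ℝ := ∑' n : ℕ, (⌈(n:ℝ) * g + t⌉ : ℝ) / 2 ^ (n+1)

lemma summable_lin (c d : ℝ) : Summable (fun n : ℕ => ((n:ℝ) * c + d) / 2 ^ (n+1)) := by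
  have h1 : Summable (fun n : ℕ => (n:ℝ)^1 * (1/2:ℝ)^n) :=
    summable_pow_mul_geometric_of_norm_lt_one 1 (by norm_num)
  have h2 : Summable (fun n : ℕ => (1/2:ℝ)^n) := summable_geometric_two
  have := (h1.mul_left (c/2)).add (h2.mul_left (d/2))
  refine this.congr (fun n => ?_)
  rw [one_div, inv_pow, pow_succ]
  field_simp
  ring

lemma abs_floor_le (x : ℝ) : |(⌊x⌋:ℝ)| ≤ |x| + 1 := by
  have h1 := Int.floor_le x
  have h2 := Int.lt_floor_add_one x
  rw [abs_le]
  constructor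
  · have := neg_abs_le x
    linarith
  · have := le_abs_self x
    linarith

lemma abs_ceil_le (x : ℝ) : |(⌈x⌉:ℝ)| ≤ |x| + 1 := by
  have h1 := Int.le_ceil x
  have h2 := Int.ceil_lt_add_one x
  rw [abs_le]
  constructor
  · have := neg_abs_le x
    linarith
  · have := le_abs_self x
    linarith

lemma abs_lin_le (n : ℕ) (g t : ℝ) : |(n:ℝ) * g + t| ≤ n * |g| + |t| := by
  calc |(n:ℝ) * g + t| ≤ |(n:ℝ) * g| + |t| := abs_add_le _ _
    _ = _ := by rw [abs_mul, Nat.abs_cast]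

lemma normf_le (n : ℕ) (g t : ℝ) : ‖(⌊(n:ℝ) * g + t⌋ : ℝ) / 2 ^ (n+1)‖ ≤ ((n:ℝ) * |g| + (|t|+1)) / 2 ^ (n+1) := by
  rw [norm_div, Real.norm_eq_abs, norm_pow, Real.norm_ofNat]
  gcongr
  linarith [abs_floor_le ((n:ℝ) * g + t), abs_lin_le n g t]

lemma normc_le (n : ℕ) (g t : ℝ) : ‖(⌈(n:ℝ) * g + t⌉ : ℝ) / 2 ^ (n+1)‖ ≤ ((n:ℝ) * |g| + (|t|+1)) / 2 ^ (n+1) := by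
  rw [norm_div, Real.norm_eq_abs, norm_pow, Real.norm_ofNat]
  gcongr
  linarith [abs_ceil_le ((n:ℝ) * g + t), abs_lin_le n g t]

lemma sumf (g t : ℝ) : Summable (fun n : ℕ => (⌊(n:ℝ) * g + t⌋ : ℝ) / 2 ^ (n+1)) :=
  Summable.of_norm_bounded (summable_lin |g| (|t|+1)) (fun n => normf_le n g t)

lemma sumc (g t : ℝ) : Summable (fun n : ℕ => (⌈(n:ℝ) * g + t⌉ : ℝ) / 2 ^ (n+1)) :=
  Summable.of_norm_bounded (summable_lin |g| (|t|+1)) (fun n => normc_le n g t)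

lemma hasSum_const (z : ℝ) : HasSum (fun n : ℕ => z / 2 ^ (n+1)) z := by
  have := hasSum_geometric_two' z
  convert this using 2 with n
  rw [pow_succ]; field_simp

lemma Xf_rec (g t : ℝ) : 2 * Xf g t = ⌊t⌋ + Xf g (t+g) := by
  unfold Xf
  rw [(sumf g t).tsum_eq_zero_add, mul_add, ← tsum_mul_left]
  congr 1
  · simp [mul_div_cancel₀]
  · refine tsum_congr (fun n => ?_)
    have : ((n+1:ℕ):ℝ) * g + t = n * g + (t+g) := by push_cast; ring
    rw [this, pow_succ _ (n+1)]; field_simp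

lemma Xc_rec (g t : ℝ) : 2 * Xc g t = ⌈t⌉ + Xc g (t+g) := by
  unfold Xc
  rw [(sumc g t).tsum_eq_zero_add, mul_add, ← tsum_mul_left]
  congr 1
  · simp [mul_div_cancel₀]
  · refine tsum_congr (fun n => ?_)
    have : ((n+1:ℕ):ℝ) * g + t = n * g + (t+g) := by push_cast; ring
    rw [this, pow_succ _ (n+1)]; field_simp

lemma Xf_add_int (g t : ℝ) (z : ℤ) : Xf g (t+z) = Xf g t + z := by
  unfold Xf
  conv_rhs => rw [← (hasSum_const (z:ℝ)).tsum_eq, ← (sumf g t).tsum_add (hasSum_const (z:ℝ)).summable]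
  refine tsum_congr (fun n => ?_)
  rw [← add_assoc, Int.floor_add_intCast]; push_cast; ring

lemma Xc_add_int (g t : ℝ) (z : ℤ) : Xc g (t+z) = Xc g t + z := by
  unfold Xc
  conv_rhs => rw [← (hasSum_const (z:ℝ)).tsum_eq, ← (sumc g t).tsum_add (hasSum_const (z:ℝ)).summable]
  refine tsum_congr (fun n => ?_)
  rw [← add_assoc, Int.ceil_add_intCast]; push_cast; ring

lemma Xf_mono (g : ℝ) {t t' : ℝ} (h : t ≤ t') : Xf g t ≤ Xf g t' := by
  refine (sumf g t).tsum_le_tsum (fun n => ?_) (sumf g t')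
  gcongr

lemma Xf_one : Xf 1 0 = 1 := by
  have h1 := Xf_rec 1 0
  have h2 := Xf_add_int 1 0 1
  simp at h1 h2
  linarith

lemma Xc_one : Xc 1 0 = 1 := by
  have h1 := Xc_rec 1 0
  have h2 := Xc_add_int 1 0 1
  simp at h1 h2
  linarith

lemma Xf_zero : Xf 0 0 = 0 := by
  simp [Xf]

/-- the mechanical point -/
def Yf (g t : ℝ) : ℝ := Xf g t - ⌊t⌋

lemma Yf_rec (g t : ℝ) : 2 * Yf g t = ((⌊t+g⌋ - ⌊t⌋ : ℤ):ℝ) + Yf g (t+g) := by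
  have := Xf_rec g t
  unfold Yf; push_cast; linarith

lemma Yf_add_int (g t : ℝ) (z : ℤ) : Yf g (t+z) = Yf g t := by
  unfold Yf; rw [Xf_add_int, Int.floor_add_intCast]; push_cast; ring

lemma Yf_fract (g t : ℝ) : Yf g t = Xf g (Int.fract t) := by
  have : Yf g t = Yf g (Int.fract t + (⌊t⌋:ℤ)) := by rw [Int.fract_add_floor]
  rw [this, Yf_add_int, Yf, Int.floor_fract]; simp

lemma Yf_pos (g t : ℝ) (h0 : 0 < g) : 0 < Yf g t := by
  rw [Yf_fract]
  have hf := Int.fract_nonneg t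
  have hz : (∑' n : ℕ, (0:ℝ)) = 0 := tsum_zero
  rw [← hz]
  obtain ⟨n, hn⟩ := exists_nat_gt (1/g)
  have hng : 1 ≤ (n:ℝ) * g := by
    rw [div_lt_iff₀ h0] at hn; exact hn.le
  refine Summable.tsum_lt_tsum (i := n) (fun m => ?_) ?_ summable_zero (sumf g _)
  · apply div_nonneg _ (by positivity)
    have : (0:ℤ) ≤ ⌊(m:ℝ) * g + Int.fract t⌋ := Int.floor_nonneg.2 (by positivity)
    exact Int.cast_nonneg this
  · apply div_pos _ (by positivity)
    have : (1:ℤ) ≤ ⌊(n:ℝ) * g + Int.fract t⌋ := Int.le_floor.2 (by push_cast; linarith)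
    exact_mod_cast (by omega : (0:ℤ) < ⌊(n:ℝ) * g + Int.fract t⌋)

lemma Yf_lt_one (g t : ℝ) (h0 : 0 < g) (h1 : g < 1) : Yf g t < 1 := by
  rw [Yf_fract, ← Xf_one]
  have hf := Int.fract_lt_one t
  obtain ⟨n, hn⟩ := exists_nat_gt (1/(1-g))
  have hng : 1 ≤ (n:ℝ) * (1-g) := by
    rw [div_lt_iff₀ (by linarith)] at hn; exact hn.le
  refine Summable.tsum_lt_tsum (i := n) (fun m => ?_) ?_ (sumf g _) (sumf 1 _)
  · gcongr ?_ / _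
    rw [mul_one, add_zero, Int.floor_natCast]
    have : ⌊(m:ℝ) * g + Int.fract t⌋ < (m:ℤ) + 1 := by
      rw [Int.floor_lt]; push_cast
      have : (m:ℝ) * g ≤ m * 1 := by gcongr
      linarith
    have h3 := Int.lt_add_one_iff.1 this
    rw [Int.cast_natCast]
    calc (⌊(m:ℝ) * g + Int.fract t⌋:ℝ) ≤ ((m:ℤ):ℝ) := Int.cast_le.2 h3
      _ = m := Int.cast_natCast m
  · gcongr ?_ / _
    rw [mul_one, add_zero, Int.floor_natCast]
    have : ⌊(n:ℝ) * g + Int.fract t⌋ < (n:ℤ) := by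
      rw [Int.floor_lt]; push_cast; linarith
    exact_mod_cast this

def Bv (g : ℝ) : ℝ := Yf g (1-g)
def Av (g : ℝ) : ℝ := Xc g (-g)

lemma floor_one_sub (g : ℝ) (h0 : 0 < g) (h1 : g < 1) : ⌊1-g⌋ = 0 := by
  rw [Int.floor_eq_iff]; constructor <;> push_cast <;> linarith

lemma ceil_neg' (g : ℝ) (h0 : 0 < g) (h1 : g < 1) : ⌈-g⌉ = 0 := by
  rw [Int.ceil_eq_iff]; constructor <;> push_cast <;> linarith

lemma Bv_eq (g : ℝ) (h0 : 0 < g) (h1 : g < 1) : Bv g = 1/2 + Xf g 0 / 2 := by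
  have h := Xf_rec g (1-g)
  have h2 := Xf_add_int g 0 1
  rw [floor_one_sub g h0 h1] at h
  have : (1 - g + g) = 0 + ((1:ℤ):ℝ) := by push_cast; ring
  rw [this, h2] at h
  unfold Bv Yf
  rw [floor_one_sub g h0 h1]; push_cast at *; linarith

lemma Av_eq (g : ℝ) (h0 : 0 < g) (h1 : g < 1) : Av g = Xc g 0 / 2 := by
  have h := Xc_rec g (-g)
  rw [ceil_neg' g h0 h1, neg_add_cancel] at h
  unfold Av
  push_cast at *; linarith

lemma Yf_g (g : ℝ) (h0 : 0 < g) (h1 : g < 1) : Yf g g = 4 * Bv g - 2 := by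
  have h := Xf_rec g 0
  have hf : ⌊g⌋ = 0 := by rw [Int.floor_eq_iff]; constructor <;> push_cast <;> linarith
  rw [Bv_eq g h0 h1, Yf, hf]
  simp at h ⊢; linarith

lemma Bv_gt (g : ℝ) (h0 : 0 < g) (h1 : g < 1) : 1/2 < Bv g := by
  have := Yf_g g h0 h1
  have := Yf_pos g g h0
  linarith

lemma Bv_lt (g : ℝ) (h0 : 0 < g) (h1 : g < 1) : Bv g < 1 := Yf_lt_one g _ h0 h1

lemma Xc_le_Xf (g : ℝ) : Xc g 0 ≤ Xf g 0 + 1/2 := by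
  have h1 := Xc_rec g 0
  have h2 := Xf_rec g 0
  have h3 := Xf_add_int g g 1
  rw [zero_add] at h1 h2
  have : Xc g g ≤ Xf g (g + (1:ℤ)) := by
    refine (sumc g _).tsum_le_tsum (fun n => ?_) (sumf g _)
    rw [← add_assoc, Int.floor_add_intCast]
    have : (⌈(n:ℝ)*g+g⌉:ℝ) ≤ ((⌊(n:ℝ)*g+g⌋ + 1 : ℤ):ℝ) :=
      Int.cast_le.2 (Int.ceil_le_floor_add_one _)
    gcongr
  simp only [Int.floor_zero, Int.ceil_zero, Int.cast_zero, Int.cast_one] at *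
  linarith

lemma Xc_eq_Xf (g : ℝ) (hg : Irrational g) : Xc g 0 = Xf g 0 + 1/2 := by
  have h1 := Xc_rec g 0
  have h2 := Xf_rec g 0
  have h3 := Xf_add_int g g 1
  rw [zero_add] at h1 h2
  have : Xc g g = Xf g (g + (1:ℤ)) := by
    refine tsum_congr (fun n => ?_)
    rw [← add_assoc, Int.floor_add_intCast]
    have hi : Irrational ((n:ℝ)*g+g) := by
      have : (n:ℝ)*g+g = ((n+1:ℕ):ℝ)*g := by push_cast; ring
      rw [this]; exact hg.natCast_mul (by omega)
    have : ⌈(n:ℝ)*g+g⌉ = ⌊(n:ℝ)*g+g⌋ + 1 := by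
      rw [Int.ceil_eq_iff]
      have h1 := Int.floor_le ((n:ℝ)*g+g)
      have h2 := Int.lt_floor_add_one ((n:ℝ)*g+g)
      have h3 := hi.ne_int ⌊(n:ℝ)*g+g⌋
      have := lt_of_le_of_ne h1 (Ne.symm h3)
      push_cast
      constructor <;> linarith
    rw [this]
  simp only [Int.floor_zero, Int.ceil_zero, Int.cast_zero, Int.cast_one] at *
  linarith

lemma Xc_mono {g g' : ℝ} (h : g ≤ g') : Xc g 0 ≤ Xc g' 0 := by
  refine (sumc g 0).tsum_le_tsum (fun n => ?_) (sumc g' 0)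
  gcongr

open Filter Topology in
lemma Xc_left (g : ℝ) : Tendsto (fun x => Xc x 0) (𝓝[<] g) (𝓝 (Xc g 0)) := by
  unfold Xc
  refine tendsto_tsum_of_dominated_convergence (summable_lin (|g|+1) (|(0:ℝ)|+1)) (fun n => ?_) ?_
  · have h1 : Tendsto (fun x : ℝ => (n:ℝ) * x + 0) (𝓝[<] g) (𝓝[≤] ((n:ℝ) * g + 0)) := by
      refine tendsto_nhdsWithin_iff.2 ⟨?_, ?_⟩
      · exact ((by fun_prop : Continuous (fun x : ℝ => (n:ℝ) * x + 0)).tendsto g).mono_left nhdsWithin_le_nhds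
      · filter_upwards [self_mem_nhdsWithin] with x hx
        have hx' : x < g := hx
        show (n:ℝ) * x + 0 ≤ n * g + 0
        gcongr
    have h2 := (tendsto_ceil_left_pure_ceil ((n:ℝ) * g + 0)).comp h1
    have h3 : ∀ᶠ x in 𝓝[<] g, ⌈(n:ℝ) * x + 0⌉ = ⌈(n:ℝ) * g + 0⌉ := tendsto_pure.1 h2
    refine Tendsto.congr' (h3.mono (fun x hx => ?_)) tendsto_const_nhds
    simp only [hx]
  · have : ∀ᶠ x in 𝓝[<] g, |x| < |g| + 1 :=
      ((continuous_abs.tendsto g).mono_left nhdsWithin_le_nhds).eventually_lt_const (by linarith)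
    refine this.mono (fun x hx n => ?_)
    refine (normc_le n x 0).trans ?_
    gcongr

open Filter Topology in
lemma Xf_right (g : ℝ) : Tendsto (fun x => Xf x 0) (𝓝[>] g) (𝓝 (Xf g 0)) := by
  unfold Xf
  refine tendsto_tsum_of_dominated_convergence (summable_lin (|g|+1) (|(0:ℝ)|+1)) (fun n => ?_) ?_
  · have h1 : Tendsto (fun x : ℝ => (n:ℝ) * x + 0) (𝓝[>] g) (𝓝[≥] ((n:ℝ) * g + 0)) := by
      refine tendsto_nhdsWithin_iff.2 ⟨?_, ?_⟩
      · exact ((by fun_prop : Continuous (fun x : ℝ => (n:ℝ) * x + 0)).tendsto g).mono_left nhdsWithin_le_nhds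
      · filter_upwards [self_mem_nhdsWithin] with x hx
        have hx' : g < x := hx
        show (n:ℝ) * g + 0 ≤ n * x + 0
        gcongr
    have h2 := (tendsto_floor_right_pure_floor ((n:ℝ) * g + 0)).comp h1
    have h3 : ∀ᶠ x in 𝓝[>] g, ⌊(n:ℝ) * x + 0⌋ = ⌊(n:ℝ) * g + 0⌋ := tendsto_pure.1 h2
    refine Tendsto.congr' (h3.mono (fun x hx => ?_)) tendsto_const_nhds
    simp only [hx]
  · have : ∀ᶠ x in 𝓝[>] g, |x| < |g| + 1 :=
      ((continuous_abs.tendsto g).mono_left nhdsWithin_le_nhds).eventually_lt_const (by linarith)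
    refine this.mono (fun x hx n => ?_)
    refine (normf_le n x 0).trans ?_
    gcongr

lemma exists_gamma (a : ℝ) (h1 : 1/4 < a) (h2 : a < 1/2) :
    ∃ g : ℝ, 0 < g ∧ g < 1 ∧ Av g ≤ a ∧ a ≤ Bv g - 1/4 := by
  set G : Set ℝ := {g | Xc g 0 ≤ 2 * a} with hG
  have hbd : BddAbove G := by
    refine ⟨1, fun g hg => ?_⟩
    by_contra hcon
    have := Xc_mono (le_of_not_ge hcon)
    have hg' : Xc g 0 ≤ 2 * a := hg
    rw [Xc_one] at this; linarith
  have h0 : (0:ℝ) ∈ G := by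
    show Xc 0 0 ≤ 2 * a
    simp [Xc]; linarith
  set g := sSup G with hg
  have hlt : ∀ x < g, Xc x 0 ≤ 2 * a := fun x hx => by
    obtain ⟨y, hy, hxy⟩ := exists_lt_of_lt_csSup ⟨0, h0⟩ hx
    exact (Xc_mono hxy.le).trans hy
  have hgt : ∀ x, g < x → 2 * a ≤ Xf x 0 + 1/2 := fun x hx => by
    have : x ∉ G := fun hx' => absurd (le_csSup hbd hx') (not_le.2 hx)
    have : 2 * a < Xc x 0 := lt_of_not_ge this
    linarith [Xc_le_Xf x]
  have hA : Xc g 0 ≤ 2 * a := le_of_tendsto (Xc_left g)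
    (Filter.eventually_of_mem self_mem_nhdsWithin (fun x hx => hlt x hx))
  have hB : 2 * a ≤ Xf g 0 + 1/2 := ge_of_tendsto ((Xf_right g).add_const _)
    (Filter.eventually_of_mem self_mem_nhdsWithin (fun x hx => hgt x hx))
  have hg0 : 0 ≤ g := le_csSup hbd h0
  have hg0' : g ≠ 0 := fun h => by
    rw [h, Xf_zero] at hB; linarith
  have hg1 : g < 1 := by
    by_contra hcon
    have := Xc_mono (not_lt.1 hcon)
    rw [Xc_one] at this; linarith
  have hpos := lt_of_le_of_ne hg0 (Ne.symm hg0')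
  refine ⟨g, hpos, hg1, ?_, ?_⟩
  · rw [Av_eq g hpos hg1]; linarith
  · rw [Bv_eq g hpos hg1]; linarith

lemma Av_irr (g : ℝ) (h0 : 0 < g) (h1 : g < 1) (hg : Irrational g) : Av g = Bv g - 1/4 := by
  rw [Av_eq g h0 h1, Bv_eq g h0 h1, Xc_eq_Xf g hg]; ring


/-! ### Part 2: mechanical points survive -/

lemma floor_step (g t : ℝ) (h0 : 0 < g) (h1 : g < 1) :
    (⌊t+g⌋ - ⌊t⌋ = 0 ∧ Int.fract t < 1 - g) ∨ (⌊t+g⌋ - ⌊t⌋ = 1 ∧ 1 - g ≤ Int.fract t) := by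
  have hf := Int.fract_add_floor t
  have hf0 := Int.fract_nonneg t
  have hf1 := Int.fract_lt_one t
  rcases lt_or_ge (Int.fract t) (1-g) with h | h
  · left
    refine ⟨?_, h⟩
    have : ⌊t+g⌋ = ⌊t⌋ := by
      rw [Int.floor_eq_iff]; constructor <;> linarith
    omega
  · right
    refine ⟨?_, h⟩
    have : ⌊t+g⌋ = ⌊t⌋ + 1 := by
      rw [Int.floor_eq_iff]; push_cast; constructor <;> linarith
    omega

lemma Dbl_Yf (g t : ℝ) (h0 : 0 < g) (h1 : g < 1) : Dbl (Yf g t) = Yf g (t+g) := by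
  have hr := Yf_rec g t
  have hp := Yf_pos g (t+g) h0
  have hl := Yf_lt_one g (t+g) h0 h1
  unfold Dbl
  rcases floor_step g t h0 h1 with ⟨h, _⟩ | ⟨h, _⟩ <;> rw [h] at hr <;> push_cast at hr
  · rw [if_pos (by linarith)]; linarith
  · rw [if_neg (by linarith)]; linarith

lemma Dbl_iter_Yf (g t : ℝ) (h0 : 0 < g) (h1 : g < 1) (n : ℕ) :
    Dbl^[n] (Yf g t) = Yf g (t + n * g) := by
  induction n with
  | zero => simp
  | succ n ih =>
    rw [Function.iterate_succ_apply', ih, Dbl_Yf g _ h0 h1]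
    congr 1; push_cast; ring

lemma Yf_not_hole (g t : ℝ) (h0 : 0 < g) (h1 : g < 1) : Yf g t ≤ Av g ∨ Bv g ≤ Yf g t := by
  rcases floor_step g t h0 h1 with ⟨_, h⟩ | ⟨_, h⟩
  · left
    rw [Yf_fract]
    refine (sumf g _).tsum_le_tsum (fun n => ?_) (sumc g _)
    have : ⌊(n:ℝ) * g + Int.fract t⌋ ≤ ⌈(n:ℝ) * g + -g⌉ := by
      apply Int.le_of_lt_add_one
      rw [Int.floor_lt]; push_cast
      have := Int.le_ceil ((n:ℝ) * g + -g)
      linarith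
    have := (Int.cast_le (R := ℝ)).2 this
    gcongr
  · right
    rw [Yf_fract, Bv, Yf, floor_one_sub g h0 h1]
    have := Xf_mono g h
    simpa using this

lemma Yf_mem_J (a b g t : ℝ) (h0 : 0 < g) (h1 : g < 1) (ha : Av g ≤ a) (hb : b ≤ Bv g) :
    Yf g t ∈ J a b := by
  refine ⟨⟨(Yf_pos g t h0).le, (Yf_lt_one g t h0 h1).le⟩, fun n hn => ?_⟩
  rw [Dbl_iter_Yf g t h0 h1] at hn
  rcases Yf_not_hole g (t + n * g) h0 h1 with h | h
  · exact absurd hn.1 (not_lt.2 (h.trans ha))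
  · exact absurd hn.2 (not_lt.2 (hb.trans h))

lemma J_ne (a b g : ℝ) (h0 : 0 < g) (h1 : g < 1) (ha : Av g ≤ a) (hb : b ≤ Bv g) :
    J a b ≠ ({0, 1} : Set ℝ) := by
  intro h
  have := Yf_mem_J a b g 0 h0 h1 ha hb
  rw [h] at this
  have hp := Yf_pos g 0 h0
  have hl := Yf_lt_one g 0 h0 h1
  rcases this with h | h
  · linarith
  · have h' : Yf g 0 = 1 := h
    linarith

lemma Xf_eq_floor (g : ℝ) {t t' : ℝ} (h : t ≤ t') (he : Xf g t = Xf g t') (n : ℕ) :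
    ⌊(n:ℝ) * g + t⌋ = ⌊(n:ℝ) * g + t'⌋ := by
  by_contra hne
  have hlt : ⌊(n:ℝ) * g + t⌋ < ⌊(n:ℝ) * g + t'⌋ := lt_of_le_of_ne (by gcongr) hne
  have : Xf g t < Xf g t' := by
    refine Summable.tsum_lt_tsum (i := n) (fun m => ?_) ?_ (sumf g _) (sumf g _)
    · gcongr
    · have := (Int.cast_lt (R := ℝ)).2 hlt
      gcongr
  linarith

lemma Xf_inj (g : ℝ) (hg : Irrational g) {t t' : ℝ} (h0 : 0 ≤ t) (h : t < t') (h1 : t' < 1) :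
    Xf g t ≠ Xf g t' := by
  intro he
  have hfl := Xf_eq_floor g h.le he
  obtain ⟨N, hN⟩ := exists_nat_gt (1/(t'-t))
  have hd : 0 < t' - t := by linarith
  have hN0 : 0 < N := by
    have : (0:ℝ) < N := lt_trans (by positivity) hN
    exact_mod_cast this
  obtain ⟨j, k, hk, -, hjk⟩ := Real.exists_int_int_abs_mul_sub_le g hN0
  lift k to ℕ using hk.le
  have hsm : (1:ℝ) / (N+1) < t' - t := by
    rw [div_lt_iff₀ (by positivity)]
    rw [div_lt_iff₀ hd] at hN
    nlinarith
  set e : ℝ := (k:ℝ) * g - j with hedef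
  have hee : |e| < t' - t := lt_of_le_of_lt (by simpa using hjk) hsm
  have hene : e ≠ 0 := by
    intro h0
    have hi : Irrational ((k:ℝ)*g) := hg.natCast_mul (by omega)
    exact hi.ne_int j (by linarith)
  have key : ∀ m : ℕ, ⌊t + m * e⌋ = ⌊t' + m * e⌋ := by
    intro m
    have := hfl (m * k)
    have e1 : ∀ s : ℝ, ((m*k:ℕ):ℝ) * g + s = (s + m * e) + ((m * j : ℤ):ℝ) := by
      intro s; rw [hedef]; push_cast; ring
    rw [e1, e1, Int.floor_add_intCast, Int.floor_add_intCast] at this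
    omega
  rw [abs_lt] at hee
  rcases lt_or_gt_of_ne hene with hneg | hpos
  · have hq : 0 ≤ t / (-e) := div_nonneg h0 (by linarith)
    have h3 := Nat.floor_le hq
    have h4 := Nat.lt_floor_add_one (t / (-e))
    rw [le_div_iff₀ (by linarith)] at h3
    rw [div_lt_iff₀ (by linarith)] at h4
    have hk := key (⌊t / (-e)⌋₊ + 1)
    push_cast at hk
    have a1 : ⌊t + ((⌊t / (-e)⌋₊:ℝ) + 1) * e⌋ < 0 := by
      rw [Int.floor_lt]; push_cast; linarith
    have a2 : 0 ≤ ⌊t' + ((⌊t / (-e)⌋₊:ℝ) + 1) * e⌋ := by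
      rw [Int.le_floor]; push_cast; linarith
    omega
  · have hq : 0 ≤ (1-t') / e := div_nonneg (by linarith) (by linarith)
    have h3 := Nat.le_ceil ((1-t') / e)
    have h4 := Nat.ceil_lt_add_one hq
    rw [div_le_iff₀ hpos] at h3
    have h4' : (⌈(1-t') / e⌉₊:ℝ) - 1 < (1-t') / e := by linarith
    rw [lt_div_iff₀ hpos] at h4'
    have hk := key (⌈(1-t') / e⌉₊)
    have a1 : ⌊t + (⌈(1-t') / e⌉₊:ℝ) * e⌋ < 1 := by
      rw [Int.floor_lt]; push_cast; linarith
    have a2 : 1 ≤ ⌊t' + (⌈(1-t') / e⌉₊:ℝ) * e⌋ := by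
      rw [Int.le_floor]; push_cast; linarith
    omega

lemma J_uncountable (a b g : ℝ) (h0 : 0 < g) (h1 : g < 1) (hg : Irrational g) (ha : Av g ≤ a)
    (hb : b ≤ Bv g) : ¬ (J a b).Countable := by
  intro hc
  have hinj : Set.InjOn (fun t => Yf g t) (Set.Ioo (0:ℝ) 1) := by
    intro t ht t' ht' he
    have e : ∀ s ∈ Set.Ioo (0:ℝ) 1, Yf g s = Xf g s := fun s hs => by
      rw [Yf_fract, Int.fract_eq_self.2 ⟨hs.1.le, hs.2⟩]
    have he' : Yf g t = Yf g t' := he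
    rw [e t ht, e t' ht'] at he'
    rcases lt_trichotomy t t' with h | h | h
    · exact absurd he' (Xf_inj g hg ht.1.le h ht'.2)
    · exact h
    · exact absurd he'.symm (Xf_inj g hg ht'.1.le h ht.2)
  have hm : Set.MapsTo (fun t => Yf g t) (Set.Ioo (0:ℝ) 1) (J a b) :=
    fun t _ => Yf_mem_J a b g t h0 h1 ha hb
  have := Set.MapsTo.countable_of_injOn hm hinj hc
  exact absurd this (Cardinal.Real.Ioo_countable_iff.not.2 (by norm_num))

/-! ### Part 3: coding of surviving orbits -/

structure Orb (a b : ℝ) (x : ℕ → ℝ) (P : ℕ → ℤ) : Prop where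
  ha : a < 1/2
  hb : 1/2 < b
  nn : ∀ n, 0 ≤ x n
  le : ∀ n, x n ≤ 1
  rc : ∀ n, 2 * x n = ((P (n+1) - P n : ℤ) : ℝ) + x (n+1)
  dg : ∀ n, (P (n+1) = P n ∧ x n ≤ a) ∨ (P (n+1) = P n + 1 ∧ b ≤ x n)

def dig (x : ℝ) (n : ℕ) : ℤ := if Dbl^[n] x ≤ 1/2 then 0 else 1
def cnt (x : ℝ) (n : ℕ) : ℤ := ∑ i ∈ Finset.range n, dig x i

lemma Dbl_mem {x : ℝ} (hx : x ∈ Set.Icc (0:ℝ) 1) : Dbl x ∈ Set.Icc (0:ℝ) 1 := by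
  unfold Dbl
  obtain ⟨h0, h1⟩ := hx
  split_ifs with h
  · constructor <;> linarith
  · constructor <;> linarith

lemma Dbl_iter_mem {x : ℝ} (hx : x ∈ Set.Icc (0:ℝ) 1) (n : ℕ) : Dbl^[n] x ∈ Set.Icc (0:ℝ) 1 := by
  induction n with
  | zero => exact hx
  | succ n ih => rw [Function.iterate_succ_apply']; exact Dbl_mem ih

lemma orb_of_mem {a b x : ℝ} (ha : a < 1/2) (hb : 1/2 < b) (hx : x ∈ J a b) :
    Orb a b (fun n => Dbl^[n] x) (cnt x) := by
  have hs : ∀ n, cnt x (n+1) = cnt x n + dig x n := fun n => Finset.sum_range_succ _ _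
  refine ⟨ha, hb, fun n => (Dbl_iter_mem hx.1 n).1, fun n => (Dbl_iter_mem hx.1 n).2,
    fun n => ?_, fun n => ?_⟩
  · rw [hs, add_sub_cancel_left, Function.iterate_succ_apply']
    unfold dig
    by_cases h : Dbl^[n] x ≤ 1/2
    · rw [if_pos h]
      conv_rhs => rw [Dbl, if_pos h]
      simp
    · rw [if_neg h]
      conv_rhs => rw [Dbl, if_neg h]
      push_cast; ring
  · have hn := hx.2 n
    rw [hs]
    unfold dig
    by_cases h : Dbl^[n] x ≤ 1/2
    · left
      rw [if_pos h]
      refine ⟨by ring, ?_⟩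
      by_contra hc
      exact hn ⟨not_le.1 hc, by linarith⟩
    · right
      rw [if_neg h]
      refine ⟨rfl, ?_⟩
      by_contra hc
      exact hn ⟨by linarith [not_le.1 h], not_le.1 hc⟩

lemma small_of_pow {c : ℝ} (h : ∀ n : ℕ, c * 2^n ≤ 1) : c ≤ 0 := by
  by_contra hc
  push Not at hc
  obtain ⟨n, hn⟩ := pow_unbounded_of_one_lt (1/c) (one_lt_two : (1:ℝ) < 2)
  rw [div_lt_iff₀ hc] at hn
  linarith [h n]

lemma Orb.all_one {a b x P} (h : Orb a b x P) (h1 : ∀ n, P (n+1) = P n + 1) : x 0 = 1 := by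
  have : ∀ n : ℕ, (1 - x 0) * 2^n = 1 - x n := by
    intro n
    induction n with
    | zero => simp
    | succ n ih =>
      have := h.rc n
      rw [h1] at this; push_cast at this
      rw [pow_succ, ← mul_assoc, ih]; linarith
  have := small_of_pow (c := 1 - x 0) (fun n => by rw [this n]; linarith [h.nn n])
  linarith [h.le 0]

lemma Orb.all_zero {a b x P} (h : Orb a b x P) (h1 : ∀ n, P (n+1) = P n) : x 0 = 0 := by
  have : ∀ n : ℕ, (x 0) * 2^n = x n := by
    intro n
    induction n with
    | zero => simp
    | succ n ih =>
      have := h.rc n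
      rw [h1] at this; push_cast at this
      rw [pow_succ, ← mul_assoc, ih]; linarith
  have := small_of_pow (c := x 0) (fun n => by rw [this n]; linarith [h.le n])
  linarith [h.nn 0]

lemma Orb.cmp_ge {a b x P} (h : Orb a b x P) {g t : ℝ} (h0 : 0 < g) (h1 : g < 1) {i K : ℕ}
    (hx : Yf g t - (1/2 - a) / 2^K < x i) (m : ℕ) (hm : m ≤ K) :
    (P (i+m) - P i = ⌊t + m * g⌋ - ⌊t⌋ ∧ (x i - Yf g t) * 2^m = x (i+m) - Yf g (t + m * g)) ∨
    ∃ k < m, P (i+k+1) = P (i+k) + 1 ∧ P (i+k) - P i = ⌊t + k * g⌋ - ⌊t⌋ ∧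
      ⌊t + k * g + g⌋ = ⌊t + k * g⌋ := by
  induction m with
  | zero => left; simp
  | succ m ih =>
    rcases ih (by omega) with ⟨e1, e2⟩ | ⟨k, hk, hk'⟩
    · have hr := Yf_rec g (t + m * g)
      have hrx := h.rc (i+m)
      have ec : t + ((m+1:ℕ):ℝ) * g = t + m * g + g := by push_cast; ring
      have ei : i + (m+1) = i + m + 1 := by ring
      have hp := Yf_pos g (t + m * g + g) h0
      rcases floor_step g (t + m * g) h0 h1 with ⟨f, _⟩ | ⟨f, _⟩ <;>
        rcases h.dg (i+m) with ⟨d, dx⟩ | ⟨d, dx⟩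
      · left
        rw [ec, ei]
        refine ⟨by omega, ?_⟩
        rw [pow_succ, ← mul_assoc, e2]
        rw [f] at hr; rw [d] at hrx; push_cast at hr hrx; linarith
      · right
        exact ⟨m, by omega, d, e1, by omega⟩
      · exfalso
        rw [f] at hr; push_cast at hr
        have h2 : (x i - Yf g t) * 2^m ≤ -(1/2 - a) := by rw [e2]; linarith
        have h3 : (1/2 - a) / 2^K * 2^m ≤ 1/2 - a := by
          have hh : (2:ℝ)^m ≤ 2^K := pow_le_pow_right₀ (by norm_num) (by omega)
          have ha := h.ha
          calc (1/2 - a) / 2^K * 2^m ≤ (1/2 - a) / 2^K * 2^K := by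
                gcongr
            _ = 1/2 - a := by field_simp
        have h4 : (Yf g t - x i) * 2^m < (1/2 - a) / 2^K * 2^m := by
          gcongr; linarith
        linarith
      · left
        rw [ec, ei]
        refine ⟨by omega, ?_⟩
        rw [pow_succ, ← mul_assoc, e2]
        rw [f] at hr; rw [d] at hrx; push_cast at hr hrx; linarith
    · right; exact ⟨k, by omega, hk'⟩

lemma Orb.cmp_le {a b x P} (h : Orb a b x P) {g t : ℝ} (h0 : 0 < g) (h1 : g < 1) {i : ℕ}
    (hx : x i ≤ Yf g t) (m : ℕ) :
    (P (i+m) - P i = ⌊t + m * g⌋ - ⌊t⌋ ∧ x (i+m) ≤ Yf g (t + m * g)) ∨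
    ∃ k < m, P (i+k+1) = P (i+k) ∧ P (i+k) - P i = ⌊t + k * g⌋ - ⌊t⌋ ∧
      ⌊t + k * g + g⌋ = ⌊t + k * g⌋ + 1 := by
  induction m with
  | zero => left; simpa using hx
  | succ m ih =>
    rcases ih with ⟨e1, e2⟩ | ⟨k, hk, hk'⟩
    · have hr := Yf_rec g (t + m * g)
      have hrx := h.rc (i+m)
      have ec : t + ((m+1:ℕ):ℝ) * g = t + m * g + g := by push_cast; ring
      have ei : i + (m+1) = i + m + 1 := by ring
      have hp := Yf_lt_one g (t + m * g + g) h0 h1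
      have hb := h.hb
      rcases floor_step g (t + m * g) h0 h1 with ⟨f, _⟩ | ⟨f, _⟩ <;>
        rcases h.dg (i+m) with ⟨d, dx⟩ | ⟨d, dx⟩
      · left
        rw [ec, ei]
        refine ⟨by omega, ?_⟩
        rw [f] at hr; rw [d] at hrx; push_cast at hr hrx; linarith
      · exfalso
        rw [f] at hr; push_cast at hr
        linarith
      · right
        exact ⟨m, by omega, d, e1, by omega⟩
      · left
        rw [ec, ei]
        refine ⟨by omega, ?_⟩
        rw [f] at hr; rw [d] at hrx; push_cast at hr hrx; linarith
    · right; exact ⟨k, by omega, hk'⟩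

/-- the upper bound after a zero -/
lemma Orb.zero_bound {a b x P} (h : Orb a b x P) {g : ℝ} (h0 : 0 < g) (h1 : g < 1)
    (hag : a ≤ Bv g - 1/4) (m : ℕ) : ∀ i, P (i+1) = P i →
    ((P (i+1+m) - P i : ℤ) : ℝ) ≤ m * g + 1 := by
  induction m using Nat.strong_induction_on with
  | _ m ih =>
  intro i hi
  have fg : ⌊g⌋ = 0 := by rw [Int.floor_eq_iff]; constructor <;> push_cast <;> linarith
  have gen : ∀ k, k < m → P (i+1+k+1) = P (i+1+k) → ((P (i+1+k) - P i : ℤ) : ℝ) ≤ (k+1) * g →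
      ((P (i+1+m) - P i : ℤ) : ℝ) ≤ m * g + 1 := by
    intro k hk h3 h4
    have h5 := ih (m-k-1) (by omega) (i+1+k) h3
    have e : i+1+k+1+(m-k-1) = i+1+m := by omega
    have e2 : ((m-k-1:ℕ):ℝ) = m - k - 1 := by
      rw [Nat.cast_sub (by omega), Nat.cast_sub (by omega)]; simp
    rw [e, e2] at h5
    push_cast at h5 h4 ⊢
    linarith
  rcases Nat.eq_zero_or_pos m with hm | hm
  · subst hm
    simp [hi]
  · have hdi : x i ≤ a := by
      rcases h.dg i with ⟨_, d⟩ | ⟨d, _⟩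
      · exact d
      · omega
    rcases h.dg (i+1) with ⟨d, dx⟩ | ⟨d, dx⟩
    · refine gen 0 hm d ?_
      simp [hi]; exact h0.le
    · have hr1 := h.rc i
      have hr2 := h.rc (i+1)
      rw [hi] at hr1; rw [d] at hr2; push_cast at hr1 hr2
      have hxx : x (i+2) ≤ Yf g g := by
        rw [Yf_g g h0 h1]
        have : x (i+2) = x (i+1+1) := rfl
        rw [this]; linarith
      rcases h.cmp_le h0 h1 hxx (m-1) with ⟨e1, _⟩ | ⟨k, hk, p1, p2, p3⟩
      · have e : i + 2 + (m-1) = i+1+m := by omega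
        have e3 : g + ((m-1:ℕ):ℝ) * g = m * g := by
          rw [Nat.cast_sub (by omega)]; push_cast; ring
        rw [e, e3, fg] at e1
        have d' : P (i+2) = P (i+1) + 1 := d
        have : P (i+1+m) - P i = ⌊(m:ℝ) * g⌋ + 1 := by omega
        rw [this]; push_cast
        linarith [Int.floor_le ((m:ℝ) * g)]
      · refine gen (k+1) (by omega) ?_ ?_
        · have e : i + 1 + (k+1) = i+2+k := by omega
          rw [e]; exact p1
        · have e : i + 1 + (k+1) = i+2+k := by omega
          rw [e]
          have d' : P (i+2) = P (i+1) + 1 := d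
          have : P (i+2+k) - P i = ⌊g + k * g + g⌋ := by omega
          rw [this]
          have := Int.floor_le (g + k * g + g)
          push_cast
          linarith

/-- no nontrivial survivors when `b > Bv g` -/
lemma Orb.trivial' {a b x P} (h : Orb a b x P) {g : ℝ} (h0 : 0 < g) (h1 : g < 1)
    (hag : a ≤ Bv g - 1/4) (hbg : Bv g < b) : x 0 = 0 ∨ x 0 = 1 := by
  by_cases hz : ∃ j, P (j+1) = P j
  swap
  · right
    refine h.all_one (fun n => ?_)
    rcases h.dg n with ⟨d, _⟩ | ⟨d, _⟩
    · exact absurd ⟨n, d⟩ hz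
    · exact d
  by_cases ho : ∃ j, P (j+1) = P j + 1
  swap
  · left
    refine h.all_zero (fun n => ?_)
    rcases h.dg n with ⟨d, _⟩ | ⟨d, _⟩
    · exact d
    · exact absurd ⟨n, d⟩ ho
  exfalso
  obtain ⟨j, hj⟩ := hz
  obtain ⟨i0, hi0⟩ := ho
  -- choose K
  obtain ⟨K, hK⟩ := pow_unbounded_of_one_lt (1/(b - Bv g)) (one_lt_two : (1:ℝ) < 2)
  rw [div_lt_iff₀ (by linarith)] at hK
  have hf0 := floor_one_sub g h0 h1
  have step : ∀ i, P (i+1) = P i + 1 → ∃ k, 1 ≤ k ∧ k < K ∧ P (i+k+1) = P (i+k) + 1 ∧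
      P (i+k) - P i = 1 + ⌊(k:ℝ) * g⌋ := by
    intro i hi
    have hxi : b ≤ x i := by
      rcases h.dg i with ⟨d, _⟩ | ⟨_, d⟩
      · omega
      · exact d
    have hx' : Yf g (1-g) - (1/2 - a) / 2^K < x i := by
      have : 0 < (1/2 - a) / 2^K := div_pos (by linarith [h.ha]) (by positivity)
      unfold Bv at hbg
      linarith
    rcases h.cmp_ge h0 h1 hx' K le_rfl with ⟨_, e2⟩ | ⟨k, hk, p1, p2, p3⟩
    · exfalso
      have a1 := h.le (i+K)
      have a2 := Yf_pos g (1 - g + K * g) h0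
      have a3 : (b - Bv g) * 2^K ≤ (x i - Yf g (1-g)) * 2^K := by
        unfold Bv; gcongr
      linarith
    · have hk1 : 1 ≤ k := by
        by_contra hc
        have : k = 0 := by omega
        subst this
        simp at p3
        rw [hf0] at p3; omega
      refine ⟨k, hk1, hk, p1, ?_⟩
      rw [p2, ← p3, hf0]
      have : 1 - g + k * g + g = k * g + ((1:ℤ):ℝ) := by push_cast; ring
      rw [this, Int.floor_add_intCast]; ring
  -- uniform gain
  have gain : ∃ δ > 0, ∀ k < K, (k:ℝ) * g + δ ≤ 1 + ⌊(k:ℝ) * g⌋ := by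
    clear hK step
    induction K with
    | zero => exact ⟨1, one_pos, fun k hk => by omega⟩
    | succ K ih =>
      obtain ⟨δ, hδ, hh⟩ := ih
      refine ⟨min δ (1 + ⌊(K:ℝ) * g⌋ - K * g), lt_min hδ ?_, fun k hk => ?_⟩
      · linarith [Int.lt_floor_add_one ((K:ℝ) * g)]
      · rcases Nat.lt_succ_iff_lt_or_eq.1 hk with hk | rfl
        · linarith [hh k hk, min_le_left δ (1 + ⌊(K:ℝ) * g⌋ - K * g)]
        · linarith [min_le_right δ (1 + ⌊(k:ℝ) * g⌋ - k * g)]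
  obtain ⟨δ, hδ, hgain⟩ := gain
  have chain : ∀ M : ℕ, ∃ i, M ≤ i ∧ P (i+1) = P i + 1 ∧
      (P i0 - i0 * g : ℝ) + M * δ ≤ P i - i * g := by
    intro M
    induction M with
    | zero => exact ⟨i0, by omega, hi0, by simp⟩
    | succ M ih =>
      obtain ⟨i, hMi, hi, hD⟩ := ih
      obtain ⟨k, hk1, hkK, p1, p2⟩ := step i hi
      refine ⟨i+k, by omega, p1, ?_⟩
      have := hgain k hkK
      have e : (P (i+k) : ℝ) = P i + (1 + ⌊(k:ℝ) * g⌋) := by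
        have : P (i+k) = P i + (1 + ⌊(k:ℝ) * g⌋) := by omega
        rw [this]; push_cast; ring
      rw [e]; push_cast; linarith
  obtain ⟨M, hM⟩ := exists_nat_gt (((P j:ℝ) - j * g + 1 - (P i0 - i0 * g))/δ)
  rw [div_lt_iff₀ hδ] at hM
  obtain ⟨i, hMi, hi, hD⟩ := chain (max M (j+1))
  have hji : j + 1 ≤ i := (le_max_right _ _).trans hMi
  have hz := h.zero_bound h0 h1 hag (i - (j+1)) j hj
  have e : j + 1 + (i - (j+1)) = i := by omega
  have e2 : ((i - (j+1) : ℕ) : ℝ) = i - j - 1 := by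
    rw [Nat.cast_sub hji]; push_cast; ring
  rw [e, e2] at hz
  push_cast at hz hD
  have : (M:ℝ) * δ ≤ max (M:ℝ) (j+1) * δ := by gcongr; exact le_max_left _ _
  nlinarith

lemma J_trivial (a b g : ℝ) (h0 : 0 < g) (h1 : g < 1) (ha : a < 1/2) (ha0 : 0 < a)
    (hb1 : b < 1) (hag : a ≤ Bv g - 1/4) (hbg : Bv g < b) : J a b = ({0, 1} : Set ℝ) := by
  have hb : 1/2 < b := (Bv_gt g h0 h1).trans hbg
  ext x
  constructor
  · intro hx
    have := (orb_of_mem ha hb hx).trivial' h0 h1 hag hbg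
    simpa using this
  · intro hx
    have d0 : Dbl 0 = 0 := by unfold Dbl; norm_num
    have d1 : Dbl 1 = 1 := by unfold Dbl; norm_num
    rcases hx with hx | hx
    · subst hx
      refine ⟨by norm_num, fun n hn => ?_⟩
      rw [Function.iterate_fixed d0] at hn
      linarith [hn.1]
    · have hx : x = 1 := hx
      subst hx
      refine ⟨by norm_num, fun n hn => ?_⟩
      rw [Function.iterate_fixed d1] at hn
      linarith [hn.2]

/-! ### Part 4: countability for rational slopes -/

lemma Orb.one_bound {a b x P} (h : Orb a b x P) {g : ℝ} (h0 : 0 < g) (h1 : g < 1)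
    {p : ℤ} {q : ℕ} (hq : 0 < q) (hpq : (q:ℝ) * g = p)
    (hbg : Bv g - (1/2 - a) / 2^q < b) (m : ℕ) : ∀ i, P (i+1) = P i + 1 →
    m * g < ((P (i+1+m) - P i : ℤ) : ℝ) := by
  induction m using Nat.strong_induction_on with
  | _ m ih =>
  intro i hi
  have hf0 := floor_one_sub g h0 h1
  have hxb : ∀ i, P (i+1) = P i + 1 → b ≤ x i := by
    intro i hi
    rcases h.dg i with ⟨d, _⟩ | ⟨_, d⟩
    · omega
    · exact d
  have gen : ∀ k, 1 ≤ k → k ≤ m → P (i+k+1) = P (i+k) + 1 → (k:ℝ) * g ≤ ((P (i+k) - P i : ℤ) : ℝ) →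
      m * g < ((P (i+1+m) - P i : ℤ) : ℝ) := by
    intro k hk1 hk h3 h4
    have h5 := ih (m-k) (by omega) (i+k) h3
    have e : i+k+1+(m-k) = i+1+m := by omega
    rw [e, Nat.cast_sub hk] at h5
    push_cast at h5 h4 ⊢
    linarith
  have hx' : Yf g (1-g) - (1/2 - a) / 2^q < x i := lt_of_lt_of_le hbg (hxb i hi)
  have genk : ∀ M, M ≤ m + 1 → (∃ k < M, P (i+k+1) = P (i+k) + 1 ∧
      P (i+k) - P i = ⌊(1-g) + k * g⌋ - ⌊1-g⌋ ∧ ⌊(1-g) + k * g + g⌋ = ⌊(1-g) + k * g⌋) →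
      m * g < ((P (i+1+m) - P i : ℤ) : ℝ) := by
    rintro M hM ⟨k, hk, p1, p2, p3⟩
    have hk1 : 1 ≤ k := by
      by_contra hc
      have : k = 0 := by omega
      subst this
      simp at p3
      rw [hf0] at p3; omega
    refine gen k hk1 (by omega) p1 ?_
    rw [p2, ← p3, hf0]
    have : 1 - g + k * g + g = k * g + ((1:ℤ):ℝ) := by push_cast; ring
    rw [this, Int.floor_add_intCast]
    push_cast
    linarith [Int.lt_floor_add_one ((k:ℝ) * g)]
  rcases Nat.lt_or_ge m q with hmq | hmq
  · rcases h.cmp_ge h0 h1 hx' (m+1) (by omega) with ⟨e1, _⟩ | hk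
    · have e : i + (m+1) = i+1+m := by omega
      have e3 : (1-g) + ((m+1:ℕ):ℝ) * g = m * g + ((1:ℤ):ℝ) := by push_cast; ring
      rw [e, e3, hf0, Int.floor_add_intCast] at e1
      rw [e1]; push_cast
      linarith [Int.lt_floor_add_one ((m:ℝ) * g)]
    · exact genk _ le_rfl hk
  · rcases h.cmp_ge h0 h1 hx' q le_rfl with ⟨e1, e2⟩ | hk
    · rw [hpq, Yf_add_int] at e2
      rw [hpq, Int.floor_add_intCast] at e1
      have h6 : -(1/2 - a) < (x i - Yf g (1-g)) * 2^q := by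
        have hp : (0:ℝ) < 2^q := by positivity
        have : (-(1/2 - a)/2^q) * 2^q < (x i - Yf g (1-g)) * 2^q := by
          gcongr
          rw [neg_div]; linarith
        rwa [div_mul_cancel₀ _ hp.ne'] at this
      have h7 := Bv_gt g h0 h1
      unfold Bv at h7
      have h8 : a < x (i+q) := by linarith
      refine gen q hq hmq ?_ ?_
      · rcases h.dg (i+q) with ⟨_, d⟩ | ⟨d, _⟩
        · linarith
        · exact d
      · rw [e1]; push_cast; linarith
    · exact genk _ (by omega) hk

lemma Orb.eventually_mech {a b x P} (h : Orb a b x P) {g : ℝ} (h0 : 0 < g) (h1 : g < 1)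
    {p : ℤ} {q : ℕ} (hq : 0 < q) (hpq : (q:ℝ) * g = p) (hag : a ≤ Bv g - 1/4)
    (hbg : Bv g - (1/2 - a) / 2^q < b) (hz : ∃ j, P (j+1) = P j) (ho : ∃ j, P (j+1) = P j + 1) :
    ∃ (n0 : ℕ) (S : ℤ), ∀ n ≥ n0, P n = (S + n * p) / q := by
  obtain ⟨j, hj⟩ := hz
  obtain ⟨i0, hi0⟩ := ho
  have hqr : (0:ℝ) < q := by exact_mod_cast hq
  have hp0 : 0 < p := by
    have : (0:ℝ) < p := by rw [← hpq]; positivity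
    exact_mod_cast this
  -- lower bounds
  have low : ∀ i, P (i+1) = P i + 1 → ∀ n ≥ i+1,
      (q * P (i+1) - (i+1) * p) - q < q * P n - n * p := by
    intro i hi n hn
    have := h.one_bound h0 h1 hq hpq hbg (n - (i+1)) i hi
    have e : i + 1 + (n - (i+1)) = n := by omega
    rw [e, Nat.cast_sub hn] at this
    have h2 := mul_lt_mul_of_pos_left this hqr
    have h3 : (q:ℝ) * ((n - ((i+1:ℕ):ℝ)) * g) = (n - ((i+1:ℕ):ℝ)) * p := by rw [← hpq]; ring
    rw [h3] at h2
    have h4 : ((n:ℤ) - (i+1)) * p < q * (P n - P i) := by exact_mod_cast h2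
    rw [hi]; linarith
  have up : ∀ n ≥ j+1, q * P n - n * p ≤ (q * P j - (j+1) * p) + q := by
    intro n hn
    have := h.zero_bound h0 h1 hag (n - (j+1)) j hj
    have e : j + 1 + (n - (j+1)) = n := by omega
    rw [e, Nat.cast_sub hn] at this
    have h2 := mul_le_mul_of_nonneg_left this hqr.le
    have h3 : (q:ℝ) * ((n - ((j+1:ℕ):ℝ)) * g + 1) = (n - ((j+1:ℕ):ℝ)) * p + q := by rw [← hpq]; ring
    rw [h3] at h2
    have h4 : q * (P n - P j) ≤ ((n:ℤ) - (j+1)) * p + q := by exact_mod_cast h2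
    linarith
  obtain ⟨S, ⟨n1, hn1⟩, hSmin⟩ := Int.exists_least_of_bdd
    (P := fun v : ℤ => ∃ n0, ∀ n ≥ n0, q * P n - n * p ≤ v)
    ⟨(q * P (i0+1) - (i0+1) * p) - q, fun z hz => by
      obtain ⟨n0, hn0⟩ := hz
      have h1 := low i0 hi0 (max n0 (i0+1)) (le_max_right _ _)
      have h2 := hn0 (max n0 (i0+1)) (le_max_left _ _)
      exact (h1.trans_le h2).le⟩
    ⟨_, j+1, up⟩
  have hex : ∃ n ≥ n1 + 1, S ≤ q * P n - n * p := by
    by_contra hc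
    push Not at hc
    have := hSmin (S-1) ⟨n1+1, fun n hn => by have := hc n hn; omega⟩
    omega
  obtain ⟨n, hn, hSn⟩ := hex
  obtain ⟨i, rfl⟩ : ∃ i, n = i + 1 := ⟨n-1, by omega⟩
  have hi1 : P (i+1) = P i + 1 := by
    rcases h.dg i with ⟨d, _⟩ | ⟨d, _⟩
    · exfalso
      have := hn1 i (by omega)
      rw [d] at hSn
      push_cast at hSn
      linarith
    · exact d
  refine ⟨i+1, S, fun n hn' => ?_⟩
  have l := low i hi1 n hn'
  have u := hn1 n (by omega)
  push_cast at hSn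
  symm
  rw [Int.ediv_eq_iff_of_pos (by omega)]
  constructor <;> linarith

lemma J_eq_of_cnt {a b x y : ℝ} (ha : a < 1/2) (hb : 1/2 < b) (hx : x ∈ J a b) (hy : y ∈ J a b)
    (he : ∀ n, cnt x n = cnt y n) : x = y := by
  have ox := orb_of_mem ha hb hx
  have oy := orb_of_mem ha hb hy
  have key : ∀ n : ℕ, (x - y) * 2^n = Dbl^[n] x - Dbl^[n] y := by
    intro n
    induction n with
    | zero => simp
    | succ n ih =>
      have h1 := ox.rc n
      have h2 := oy.rc n
      simp only [he] at h1
      rw [pow_succ, ← mul_assoc, ih]; linarith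
  apply le_antisymm
  · have := small_of_pow (c := x - y) (fun n => by
      rw [key n]; linarith [ox.le n, oy.nn n])
    linarith
  · have := small_of_pow (c := y - x) (fun n => by
      have := key n
      have : (y - x) * 2^n = Dbl^[n] y - Dbl^[n] x := by linarith
      rw [this]; linarith [oy.le n, ox.nn n])
    linarith

lemma J_countable (a b g : ℝ) (h0 : 0 < g) (h1 : g < 1) {p : ℤ} {q : ℕ} (hq : 0 < q)
    (hpq : (q:ℝ) * g = p) (ha : a < 1/2) (hb : 1/2 < b) (hag : a ≤ Bv g - 1/4)
    (hbg : Bv g - (1/2 - a) / 2^q < b) : (J a b).Countable := by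
  set C : ℕ × ℤ × List ℤ → Set ℝ := fun w =>
    {x ∈ J a b | (∀ n ≥ w.1, cnt x n = (w.2.1 + n * p) / q) ∧ (List.range w.1).map (cnt x) = w.2.2}
    with hC
  have hsub : J a b ⊆ ({0, 1} : Set ℝ) ∪ ⋃ w, C w := by
    intro x hx
    have ox := orb_of_mem ha hb hx
    by_cases hz : ∃ j, cnt x (j+1) = cnt x j
    swap
    · left; right
      exact ox.all_one (fun n => by
        rcases ox.dg n with ⟨d, _⟩ | ⟨d, _⟩
        · exact absurd ⟨n, d⟩ hz
        · exact d)
    by_cases ho : ∃ j, cnt x (j+1) = cnt x j + 1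
    swap
    · left; left
      exact ox.all_zero (fun n => by
        rcases ox.dg n with ⟨d, _⟩ | ⟨d, _⟩
        · exact d
        · exact absurd ⟨n, d⟩ ho)
    right
    obtain ⟨n0, S, hS⟩ := ox.eventually_mech h0 h1 hq hpq hag hbg hz ho
    exact Set.mem_iUnion.2 ⟨(n0, S, (List.range n0).map (cnt x)), hx, hS, rfl⟩
  refine Set.Countable.mono hsub (Set.Countable.union ?_ (Set.countable_iUnion (fun w => ?_)))
  · exact (Set.toFinite _).countable
  · refine Set.Subsingleton.countable (fun x hx y hy => ?_)
    refine J_eq_of_cnt ha hb hx.1 hy.1 (fun n => ?_)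
    rcases Nat.lt_or_ge n w.1 with hn | hn
    · have := hx.2.2.trans hy.2.2.symm
      rw [List.map_inj_left] at this
      exact this n (List.mem_range.2 hn)
    · rw [hx.2.1 n hn, hy.2.1 n hn]


/-! ### Part 5: balanced words -/

lemma lex_of_counts : ∀ v w : List Bool, v.length = w.length →
    (∀ n ≤ v.length, (v.take n).count true ≤ (w.take n).count true) → v = w ∨ List.Lex (· < ·) v w
  | [], [], _, _ => Or.inl rfl
  | [], _ :: _, h, _ => by simp at h
  | _ :: _, [], h, _ => by simp at h
  | x :: v, y :: w, h, hc => by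
    by_cases hxy : x = y
    · subst hxy
      have hl : v.length = w.length := by simpa using h
      rcases lex_of_counts v w hl (fun n hn => by
        have := hc (n+1) (by simpa using hn)
        simp only [List.take_succ_cons, List.count_cons] at this
        omega) with h' | h'
      · left; rw [h']
      · right; exact List.Lex.cons h'
    · right
      have := hc 1 (by simp)
      cases x <;> cases y <;> simp at hxy this ⊢
      exact List.Lex.rel (by decide)

lemma lex_asymm : ∀ v w : List Bool, List.Lex (· < ·) v w → List.Lex (· < ·) w v → False
  | _, _, List.Lex.nil, h => by cases h
  | _, _, List.Lex.cons h1, h => by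
    cases h with
    | cons h2 => exact lex_asymm _ _ h1 h2
    | rel h2 => exact absurd h2 (lt_irrefl _)
  | _, _, List.Lex.rel h1, h => by
    cases h with
    | cons h2 => exact absurd h1 (lt_irrefl _)
    | rel h2 => exact absurd h1 (lt_asymm h2)

lemma omegaPlus_eq {r : ℚ} {w : List Bool} (h : IsOmegaPlus r w) : omegaPlus r = w := by
  have hex : ∃ w, IsOmegaPlus r w := ⟨w, h⟩
  unfold omegaPlus
  rw [dif_pos hex]
  have h' := hex.choose_spec
  rcases h.2 _ h'.1 with h1 | h1
  · exact h1
  · rcases h'.2 _ h.1 with h2 | h2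
    · exact h2.symm
    · exact (lex_asymm _ _ h1 h2).elim

lemma omegaMinus_eq {r : ℚ} {w : List Bool} (h : IsOmegaMinus r w) : omegaMinus r = w := by
  have hex : ∃ w, IsOmegaMinus r w := ⟨w, h⟩
  unfold omegaMinus
  rw [dif_pos hex]
  have h' := hex.choose_spec
  rcases h.2 _ h'.1 with h1 | h1
  · exact h1
  · rcases h'.2 _ h.1 with h2 | h2
    · exact h2.symm
    · exact (lex_asymm _ _ h1 h2).elim

/-- word whose prefix counts are given by `F` -/
def wrd (F : ℕ → ℤ) (N : ℕ) : List Bool := (List.range N).map (fun n => decide (F (n+1) = F n + 1))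

lemma wrd_length (F : ℕ → ℤ) (N : ℕ) : (wrd F N).length = N := by simp [wrd]

lemma wrd_take (F : ℕ → ℤ) (N n : ℕ) (h : n ≤ N) : (wrd F N).take n = wrd F n := by
  unfold wrd
  rw [← List.map_take, List.take_range, min_eq_left h]

lemma wrd_count (F : ℕ → ℤ) (h0 : F 0 = 0) (hs : ∀ n, F (n+1) = F n ∨ F (n+1) = F n + 1) (n : ℕ) :
    ((wrd F n).count true : ℤ) = F n := by
  induction n with
  | zero => simp [wrd, h0]
  | succ n ih =>
    have : wrd F (n+1) = wrd F n ++ [decide (F (n+1) = F n + 1)] := by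
      unfold wrd; rw [List.range_succ, List.map_append]; rfl
    rw [this, List.count_append]
    push_cast
    rw [ih]
    rcases hs n with h | h <;> simp [h]

lemma wrd_double (F : ℕ → ℤ) (q : ℕ) (p : ℤ) (hp : ∀ n, F (n+q) = F n + p) :
    wrd F q ++ wrd F q = wrd F (q+q) := by
  unfold wrd
  rw [List.range_add, List.map_append, List.map_map]
  congr 1
  apply List.map_congr_left
  intro n _
  have e : q + n + 1 = (n+1) + q := by ring
  have e2 : q + n = n + q := by ring
  have h1 : F (q+n+1) = F (n+1) + p := by rw [e, hp]
  have h2 : F (q+n) = F n + p := by rw [e2, hp]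
  show decide (F (n+1) = F n + 1) = decide (F (q+n+1) = F (q+n) + 1)
  rw [decide_eq_decide]
  constructor <;> intro h <;> omega

lemma infix_count {u l : List Bool} (h : u <:+: l) :
    ∃ i, i + u.length ≤ l.length ∧
      u.count true + (l.take i).count true = (l.take (i + u.length)).count true := by
  obtain ⟨s, t, rfl⟩ := h
  refine ⟨s.length, by simp, ?_⟩
  have e1 : (s ++ u ++ t).take s.length = s := by
    rw [List.append_assoc, List.take_left]
  have e2 : (s ++ u ++ t).take (s.length + u.length) = s ++ u := by
    rw [← List.length_append, List.take_left]
  rw [e1, e2, List.count_append, add_comm]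

lemma window_infix (l : List Bool) (i m : ℕ) (h : i + m ≤ l.length) :
    ∃ u, u <:+: l ∧ u.length = m ∧
      u.count true + (l.take i).count true = (l.take (i+m)).count true := by
  refine ⟨(l.drop i).take m, ?_, by simp; omega, ?_⟩
  · exact (List.take_prefix _ _).isInfix.trans (List.drop_suffix _ _).isInfix
  · rw [List.take_add, List.count_append, add_comm]

lemma wrd_cyc (F : ℕ → ℤ) (h0 : F 0 = 0) (hs : ∀ n, F (n+1) = F n ∨ F (n+1) = F n + 1)
    (q : ℕ) (p : ℤ) (hp : ∀ n, F (n+q) = F n + p)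
    (hb : ∀ i j m, (F (i+m) - F i) - (F (j+m) - F j) ≤ 1) : CycBalanced (wrd F q) := by
  unfold CycBalanced
  rw [wrd_double F q p hp]
  intro u v hu hv huv
  obtain ⟨i, hi, ei⟩ := infix_count hu
  obtain ⟨j, hj, ej⟩ := infix_count hv
  rw [wrd_length] at hi hj
  rw [wrd_take F _ _ (by omega), wrd_take F _ _ (by omega)] at ei ej
  have c := wrd_count F h0 hs
  have := hb i j u.length
  rw [← c, ← c, ← c, ← c] at this
  rw [← huv] at ej
  omega

lemma omega_bound {r : ℚ} {b : Bool} {w : List Bool} (hw : w ∈ OmegaSet r b)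
    (m : ℕ) (hm : m < r.den) :
    (m:ℤ) * r.num.toNat < r.den * (((w.take (1+m)).count true : ℤ) - ((w.take 1).count true : ℤ) + 1) ∧
    r.den * (((w.take (1+m)).count true : ℤ) - ((w.take 1).count true : ℤ) - 1) < (m:ℤ) * r.num.toNat := by
  obtain ⟨hlen, hcnt, hcyc, _⟩ := hw
  set q := r.den
  set p := r.num.toNat
  have hq : 0 < q := r.den_pos
  set c : ℕ → ℤ := fun n => (((w++w).take n).count true : ℤ) with hc
  have hll : (w++w).length = q + q := by simp [hlen]
  have hbal : ∀ i j m, i + m ≤ q + q → j + m ≤ q + q → (c (i+m) - c i) - (c (j+m) - c j) ≤ 1 := by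
    intro i j m hi hj
    obtain ⟨u, hu, lu, eu⟩ := window_infix (w++w) i m (by omega)
    obtain ⟨v, hv, lv, ev⟩ := window_infix (w++w) j m (by omega)
    have := hcyc u v hu hv (by omega)
    simp only [hc]
    omega
  have hper : ∀ n ≤ q, c (q+n) = p + c n := by
    intro n hn
    simp only [hc]
    have e1 : (w++w).take (q+n) = w ++ w.take n := by
      rw [← hlen, List.take_length_add_append]
    have e2 : (w++w).take n = w.take n := by
      rw [List.take_append_of_le_length (by omega)]
    rw [e1, e2, List.count_append, hcnt]; push_cast; rfl
  have hsum : ∀ m ≤ q, ∑ i ∈ Finset.range q, (c (i+m) - c i) = m * p := by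
    intro m
    induction m with
    | zero => intro _; simp
    | succ m ih =>
      intro hm
      have ih' := ih (by omega)
      have : ∑ i ∈ Finset.range q, (c (i+(m+1)) - c (i+m)) = p := by
        have := Finset.sum_range_sub (fun i => c (i+m)) q
        simp only [zero_add] at this
        have e : ∀ i, c (i+(m+1)) = c (i+1+m) := fun i => by congr 1; ring
        simp only [e, this]
        rw [hper m (by omega)]; ring
      have e : ∑ i ∈ Finset.range q, (c (i+(m+1)) - c i) =
          ∑ i ∈ Finset.range q, (c (i+(m+1)) - c (i+m)) + ∑ i ∈ Finset.range q, (c (i+m) - c i) := by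
        rw [← Finset.sum_add_distrib]
        exact Finset.sum_congr rfl (fun i _ => by ring)
      rw [e, this, ih']; push_cast; ring
  have hcw : ∀ n ≤ q, c n = (w.take n).count true := by
    intro n hn
    simp only [hc]
    rw [List.take_append_of_le_length (by omega)]
  rw [← hcw (1+m) (by omega), ← hcw 1 (by omega)]
  set N := c (1+m) - c 1 with hN
  have hs := hsum m hm.le
  -- index equal to 1 modulo q
  obtain ⟨i1, hi1, hNi⟩ : ∃ i1 ∈ Finset.range q, c (i1+m) - c i1 = N := by
    rcases Nat.lt_or_ge 1 q with h | h
    · exact ⟨1, Finset.mem_range.2 h, rfl⟩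
    · have hq1 : q = 1 := by omega
      refine ⟨0, Finset.mem_range.2 hq, ?_⟩
      have hm0 : m = 0 := by omega
      subst hm0
      simp [hN]
  have hcard : ∑ _i ∈ Finset.range q, (N+1) = q * (N+1) := by simp
  have hcard' : ∑ _i ∈ Finset.range q, (N-1) = q * (N-1) := by
    rw [Finset.sum_const, Finset.card_range, nsmul_eq_mul]
  rw [← hs, ← hcard, ← hcard']
  constructor
  · refine Finset.sum_lt_sum (fun i hi => ?_) ⟨i1, hi1, by omega⟩
    have := hbal i 1 m (by have := Finset.mem_range.1 hi; omega) (by omega)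
    omega
  · refine Finset.sum_lt_sum (fun i hi => ?_) ⟨i1, hi1, by omega⟩
    have := hbal 1 i m (by omega) (by have := Finset.mem_range.1 hi; omega)
    omega

def Ft (g : ℝ) (n : ℕ) : ℤ := ⌊(1-g) + n * g⌋
def Fs (g : ℝ) (n : ℕ) : ℤ := ⌈-g + n * g⌉

lemma floor_step' (g t : ℝ) (h0 : 0 < g) (h1 : g < 1) : ⌊t+g⌋ = ⌊t⌋ ∨ ⌊t+g⌋ = ⌊t⌋ + 1 := by
  rcases floor_step g t h0 h1 with ⟨h, _⟩ | ⟨h, _⟩ <;> omega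

lemma ceil_step' (g t : ℝ) (h0 : 0 < g) (h1 : g < 1) : ⌈t+g⌉ = ⌈t⌉ ∨ ⌈t+g⌉ = ⌈t⌉ + 1 := by
  have := floor_step' g (-(t+g)) h0 h1
  have e : -(t+g) + g = -t := by ring
  rw [e, Int.floor_neg, Int.floor_neg] at this
  omega

lemma num_toNat {r : ℚ} (h0 : 0 < r) : (r.num.toNat : ℤ) = r.num :=
  Int.toNat_of_nonneg (Rat.num_pos.2 h0).le

lemma den_mul {r : ℚ} : (r.den:ℝ) * (r:ℝ) = (r.num:ℝ) := by
  have := Rat.den_mul_eq_num r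
  exact_mod_cast this

lemma Ft_zero {g : ℝ} (h0 : 0 < g) (h1 : g < 1) : Ft g 0 = 0 := by
  simp [Ft, floor_one_sub g h0 h1]

lemma Fs_zero {g : ℝ} (h0 : 0 < g) (h1 : g < 1) : Fs g 0 = 0 := by
  simp only [Fs, Nat.cast_zero, zero_mul, add_zero, ceil_neg' g h0 h1]

lemma Ft_step {g : ℝ} (h0 : 0 < g) (h1 : g < 1) (n : ℕ) :
    Ft g (n+1) = Ft g n ∨ Ft g (n+1) = Ft g n + 1 := by
  have e : (1-g) + ((n+1:ℕ):ℝ) * g = (1-g) + n * g + g := by push_cast; ring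
  unfold Ft
  rw [e]; exact floor_step' g _ h0 h1

lemma Fs_step {g : ℝ} (h0 : 0 < g) (h1 : g < 1) (n : ℕ) :
    Fs g (n+1) = Fs g n ∨ Fs g (n+1) = Fs g n + 1 := by
  have e : (-g) + ((n+1:ℕ):ℝ) * g = (-g) + n * g + g := by push_cast; ring
  unfold Fs
  rw [e]; exact ceil_step' g _ h0 h1

lemma Ft_per (r : ℚ) (n : ℕ) : Ft r (n + r.den) = Ft r n + r.num := by
  unfold Ft
  have : (1 - (r:ℝ)) + ((n + r.den : ℕ):ℝ) * r = ((1 - (r:ℝ)) + n * r) + ((r.num:ℤ):ℝ) := by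
    rw [← den_mul]; push_cast; ring
  rw [this, Int.floor_add_intCast]

lemma Fs_per (r : ℚ) (n : ℕ) : Fs r (n + r.den) = Fs r n + r.num := by
  unfold Fs
  have : (-(r:ℝ)) + ((n + r.den : ℕ):ℝ) * r = ((-(r:ℝ)) + n * r) + ((r.num:ℤ):ℝ) := by
    rw [← den_mul]; push_cast; ring
  rw [this, Int.ceil_add_intCast]

lemma Ft_bal (g : ℝ) (i j m : ℕ) : (Ft g (i+m) - Ft g i) - (Ft g (j+m) - Ft g j) ≤ 1 := by
  unfold Ft
  have a1 := Int.floor_le ((1-g) + ((i+m:ℕ):ℝ) * g)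
  have a2 := Int.lt_floor_add_one ((1-g) + (i:ℝ) * g)
  have a3 := Int.floor_le ((1-g) + (j:ℝ) * g)
  have a4 := Int.lt_floor_add_one ((1-g) + ((j+m:ℕ):ℝ) * g)
  apply Int.le_of_lt_add_one
  have : ((⌊(1-g) + ((i+m:ℕ):ℝ) * g⌋ - ⌊(1-g) + (i:ℝ) * g⌋ - (⌊(1-g) + ((j+m:ℕ):ℝ) * g⌋ - ⌊(1-g) + (j:ℝ) * g⌋) : ℤ) : ℝ) < ((1 + 1:ℤ):ℝ) := by
    push_cast at *; linarith
  exact Int.cast_lt.1 this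

lemma Fs_bal (g : ℝ) (i j m : ℕ) : (Fs g (i+m) - Fs g i) - (Fs g (j+m) - Fs g j) ≤ 1 := by
  unfold Fs
  have a1 := Int.ceil_lt_add_one ((-g) + ((i+m:ℕ):ℝ) * g)
  have a2 := Int.le_ceil ((-g) + (i:ℝ) * g)
  have a3 := Int.ceil_lt_add_one ((-g) + (j:ℝ) * g)
  have a4 := Int.le_ceil ((-g) + ((j+m:ℕ):ℝ) * g)
  apply Int.le_of_lt_add_one
  have : ((⌈(-g) + ((i+m:ℕ):ℝ) * g⌉ - ⌈(-g) + (i:ℝ) * g⌉ - (⌈(-g) + ((j+m:ℕ):ℝ) * g⌉ - ⌈(-g) + (j:ℝ) * g⌉) : ℤ) : ℝ) < ((1 + 1:ℤ):ℝ) := by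
    push_cast at *; linarith
  exact Int.cast_lt.1 this

lemma wrd_mem {r : ℚ} (h0 : 0 < r) {F : ℕ → ℤ} (hF0 : F 0 = 0)
    (hs : ∀ n, F (n+1) = F n ∨ F (n+1) = F n + 1) (hp : ∀ n, F (n + r.den) = F n + r.num)
    (hb : ∀ i j m, (F (i+m) - F i) - (F (j+m) - F j) ≤ 1) (b : Bool) (hh : decide (F 1 = F 0 + 1) = b) :
    wrd F r.den ∈ OmegaSet r b := by
  refine ⟨wrd_length _ _, ?_, wrd_cyc F hF0 hs _ _ hp hb, ?_⟩
  · have c := wrd_count F hF0 hs r.den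
    have := hp 0
    rw [zero_add, hF0] at this
    have := num_toNat h0
    omega
  · obtain ⟨k, hk⟩ : ∃ k, r.den = k + 1 := ⟨r.den - 1, by have := r.den_pos; omega⟩
    rw [hk]
    simp [wrd, List.range_succ_eq_map]
    simpa using hh

lemma take_one_count {w : List Bool} {b : Bool} (h : w.head? = some b) :
    (w.take 1).count true = if b then 1 else 0 := by
  cases w with
  | nil => simp at h
  | cons x w =>
    simp at h; subst h
    cases x <;> simp

lemma isPlus {r : ℚ} (h0 : 0 < r) (h1 : r < 1) : IsOmegaPlus r (wrd (Ft r) r.den) := by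
  have g0 : (0:ℝ) < r := by exact_mod_cast h0
  have g1 : (r:ℝ) < 1 := by exact_mod_cast h1
  have hF1 : Ft r 1 = 1 := by simp [Ft]
  refine ⟨wrd_mem h0 (Ft_zero g0 g1) (Ft_step g0 g1) (Ft_per r) (Ft_bal r) true (by
    rw [hF1, Ft_zero g0 g1]; rfl), fun v hv => ?_⟩
  have hl := hv.1
  have := lex_of_counts (wrd (Ft r) r.den) v (by rw [wrd_length, hl]) (fun n hn => by
    rw [wrd_length] at hn
    rw [wrd_take _ _ _ hn]
    have c := wrd_count (Ft r) (Ft_zero g0 g1) (Ft_step g0 g1) n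
    rcases Nat.eq_zero_or_pos n with hn0 | hn0
    · subst hn0; simp [wrd]
    · obtain ⟨m, rfl⟩ : ∃ m, n = 1 + m := ⟨n-1, by omega⟩
      have hb := (omega_bound hv m (by omega)).1
      have t1 := take_one_count hv.2.2.2
      rw [if_pos rfl] at t1
      rw [t1, num_toNat h0] at hb
      have : Ft r (1+m) < (v.take (1+m)).count true + 1 := by
        unfold Ft
        rw [Int.floor_lt]
        have hb' : (m:ℝ) * r.num < r.den * (((v.take (1+m)).count true : ℝ)) := by
          have hb2 : (m:ℤ) * r.num < r.den * (((v.take (1+m)).count true : ℤ)) := by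
            convert hb using 2; push_cast; ring
          exact_mod_cast hb2
        rw [← den_mul] at hb'
        have hq : (0:ℝ) < r.den := by exact_mod_cast r.den_pos
        have hb3 : (m:ℝ) * r < ((v.take (1+m)).count true : ℝ) := by
          apply lt_of_mul_lt_mul_left _ hq.le
          linarith
        push_cast; linarith
      omega)
  rcases this with h | h
  · exact Or.inl h.symm
  · exact Or.inr h

lemma isMinus {r : ℚ} (h0 : 0 < r) (h1 : r < 1) : IsOmegaMinus r (wrd (Fs r) r.den) := by
  have g0 : (0:ℝ) < r := by exact_mod_cast h0
  have g1 : (r:ℝ) < 1 := by exact_mod_cast h1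
  have hF1 : Fs r 1 = 0 := by simp [Fs]
  refine ⟨wrd_mem h0 (Fs_zero g0 g1) (Fs_step g0 g1) (Fs_per r) (Fs_bal r) false (by
    rw [hF1, Fs_zero g0 g1]; rfl), fun v hv => ?_⟩
  have hl := hv.1
  exact lex_of_counts v (wrd (Fs r) r.den) (by rw [wrd_length, hl]) (fun n hn => by
    rw [hl] at hn
    rw [wrd_take _ _ _ hn]
    have c := wrd_count (Fs r) (Fs_zero g0 g1) (Fs_step g0 g1) n
    rcases Nat.eq_zero_or_pos n with hn0 | hn0
    · subst hn0; simp
    · obtain ⟨m, rfl⟩ : ∃ m, n = 1 + m := ⟨n-1, by omega⟩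
      have hb := (omega_bound hv m (by omega)).2
      have t1 := take_one_count hv.2.2.2
      rw [if_neg (by simp)] at t1
      rw [t1, num_toNat h0] at hb
      have : ((v.take (1+m)).count true : ℤ) - 1 < Fs r (1+m) := by
        unfold Fs
        rw [Int.lt_ceil]
        have hb' : r.den * (((v.take (1+m)).count true : ℝ) - 1) < (m:ℝ) * r.num := by
          have hb2 : r.den * (((v.take (1+m)).count true : ℤ) - 1) < (m:ℤ) * r.num := by
            convert hb using 2; push_cast; ring
          exact_mod_cast hb2
        rw [← den_mul] at hb'
        have hq : (0:ℝ) < r.den := by exact_mod_cast r.den_pos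
        have hb3 : ((v.take (1+m)).count true : ℝ) - 1 < (m:ℝ) * r := by
          apply lt_of_mul_lt_mul_left _ hq.le
          linarith
        push_cast; linarith
      omega)

lemma per_wrd (F : ℕ → ℤ) (q : ℕ) (hq : 0 < q) (p : ℤ) (hp : ∀ n, F (n+q) = F n + p) (n : ℕ) :
    per (wrd F q) n = decide (F (n+1) = F n + 1) := by
  have hk : ∀ k m, F (m + k * q) = F m + k * p := by
    intro k m
    induction k with
    | zero => simp
    | succ k ih =>
      have : m + (k+1) * q = (m + k * q) + q := by ring
      rw [this, hp, ih]; push_cast; ring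
  unfold per
  rw [wrd_length]
  have hm : n % q < q := Nat.mod_lt _ hq
  have e : (wrd F q).getD (n % q) false = decide (F (n % q + 1) = F (n % q) + 1) := by
    simp [wrd, List.getD, hm]
  rw [e]
  have e1 : F n = F (n % q) + (n / q : ℕ) * p := by
    rw [← hk]; congr 1; rw [mul_comm]; exact (Nat.mod_add_div n q).symm
  have e2 : F (n+1) = F (n % q + 1) + (n / q : ℕ) * p := by
    rw [← hk]; congr 1
    have := Nat.mod_add_div n q
    rw [mul_comm (n/q) q]; omega
  rw [e1, e2]
  congr 1
  apply propext
  constructor <;> intro h <;> linarith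

open Filter Topology in
lemma piMap_eq (L : ℕ → Bool) (Y : ℕ → ℝ) (l u : ℝ) (hl : ∀ n, l ≤ Y n) (hu : ∀ n, Y n ≤ u)
    (hr : ∀ n, 2 * Y n = (if L n then 1 else 0) + Y (n+1)) : piMap L = Y 0 := by
  have hpart : ∀ N, ∑ n ∈ Finset.range N, (if L n then (1:ℝ) else 0) / 2^(n+1) = Y 0 - Y N / 2^N := by
    intro N
    induction N with
    | zero => simp
    | succ N ih =>
      rw [Finset.sum_range_succ, ih]
      have : Y N = ((if L N then 1 else 0) + Y (N+1)) / 2 := by linarith [hr N]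
      rw [this, pow_succ]; field_simp; ring
  have hlim : ∀ c : ℝ, Tendsto (fun N : ℕ => c / 2^N) atTop (𝓝 0) := by
    intro c
    have := (tendsto_pow_atTop_nhds_zero_of_lt_one (r := (1/2:ℝ)) (by norm_num) (by norm_num)).const_mul c
    rw [mul_zero] at this
    refine this.congr (fun N => ?_)
    rw [one_div, inv_pow]; rfl
  have hz : Tendsto (fun N : ℕ => Y N / 2^N) atTop (𝓝 0) := by
    refine tendsto_of_tendsto_of_tendsto_of_le_of_le (hlim l) (hlim u) (fun N => ?_) (fun N => ?_)
    · have := hl N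
      show l / 2^N ≤ Y N / 2^N
      gcongr
    · have := hu N
      show Y N / 2^N ≤ u / 2^N
      gcongr
  have hS : HasSum (fun n => (if L n then (1:ℝ) else 0) / 2^(n+1)) (Y 0) := by
    rw [hasSum_iff_tendsto_nat_of_nonneg (fun n => by positivity)]
    have := hz.const_sub (Y 0)
    rw [sub_zero] at this
    exact this.congr (fun N => (hpart N).symm)
  exact hS.tsum_eq

lemma if_dec {a b : ℤ} (h : a = b ∨ a = b + 1) :
    (if (decide (a = b + 1)) = true then (1:ℝ) else 0) = ((a - b : ℤ) : ℝ) := by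
  rcases h with h | h <;> simp [h]

lemma piMap_t {r : ℚ} (h0 : 0 < r) (h1 : r < 1) : piMap (per (wrd (Ft r) r.den)) = Bv r := by
  have g0 : (0:ℝ) < r := by exact_mod_cast h0
  have g1 : (r:ℝ) < 1 := by exact_mod_cast h1
  rw [piMap_eq _ (fun n => Yf r ((1-r) + n * r)) 0 1 (fun n => (Yf_pos r _ g0).le)
    (fun n => (Yf_lt_one r _ g0 g1).le)]
  · simp [Bv]
  · intro n
    rw [per_wrd _ _ r.den_pos _ (Ft_per r), if_dec (Ft_step g0 g1 n)]
    have e : (1-(r:ℝ)) + ((n+1:ℕ):ℝ) * r = (1-r) + n * r + r := by push_cast; ring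
    rw [Ft, Ft, e]
    exact Yf_rec _ _

lemma Xc_monot (g : ℝ) {t t' : ℝ} (h : t ≤ t') : Xc g t ≤ Xc g t' := by
  refine (sumc g t).tsum_le_tsum (fun n => ?_) (sumc g t')
  gcongr

lemma piMap_s {r : ℚ} (h0 : 0 < r) (h1 : r < 1) : piMap (per (wrd (Fs r) r.den)) = Av r := by
  have g0 : (0:ℝ) < r := by exact_mod_cast h0
  have g1 : (r:ℝ) < 1 := by exact_mod_cast h1
  have hY : ∀ t : ℝ, Xc r t - ⌈t⌉ = Xc r (t - ⌈t⌉) := fun t => by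
    have := Xc_add_int r t (-⌈t⌉)
    push_cast at this
    rw [← sub_eq_add_neg, ← sub_eq_add_neg] at this
    exact this.symm
  rw [piMap_eq _ (fun n => Xc r (-r + n * r) - ⌈-(r:ℝ) + n * r⌉) (Xc r (-1)) (Xc r 0)]
  · simp only [Nat.cast_zero, zero_mul, add_zero, ceil_neg' _ g0 g1, Av]; simp
  · intro n
    rw [hY]
    apply Xc_monot
    have := Int.ceil_lt_add_one (-(r:ℝ) + n * r)
    linarith
  · intro n
    rw [hY]
    apply Xc_monot
    have := Int.le_ceil (-(r:ℝ) + n * r)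
    linarith
  · intro n
    rw [per_wrd _ _ r.den_pos _ (Fs_per r), if_dec (Fs_step g0 g1 n)]
    have e : (-(r:ℝ)) + ((n+1:ℕ):ℝ) * r = (-r) + n * r + r := by push_cast; ring
    rw [Fs, Fs, e]
    have := Xc_rec r (-(r:ℝ) + n * r)
    push_cast; linarith

lemma piMap_summable (L : ℕ → Bool) : Summable (fun n => (if L n then (1:ℝ) else 0) / 2^(n+1)) := by
  refine Summable.of_nonneg_of_le (fun n => by positivity) (fun n => ?_) (hasSum_const 1).summable
  gcongr
  split_ifs <;> norm_num

lemma piMap_diff (u v : ℕ → Bool) (hu0 : u 0 = true) (hu1 : u 1 = false) (hv0 : v 0 = false)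
    (hv1 : v 1 = true) (h : ∀ n, u (n+2) = v (n+2)) : piMap v = piMap u - 1/4 := by
  unfold piMap
  rw [← (piMap_summable u).sum_add_tsum_nat_add 2, ← (piMap_summable v).sum_add_tsum_nat_add 2]
  simp only [h]
  simp [Finset.sum_range_succ, hu0, hu1, hv0, hv1]
  ring

lemma Fs_Ft {r : ℚ} (h1 : r < 1) (n : ℕ) (h : 2 ≤ n) (hn : n ≤ r.den) :
    Fs r n = Ft r n := by
  obtain ⟨m, rfl⟩ : ∃ m, n = 1 + m := ⟨n-1, by omega⟩
  unfold Fs Ft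
  have e1 : -(r:ℝ) + ((1+m:ℕ):ℝ) * r = m * r := by push_cast; ring
  have e2 : 1-(r:ℝ) + ((1+m:ℕ):ℝ) * r = m * r + ((1:ℤ):ℝ) := by push_cast; ring
  rw [e1, e2, Int.floor_add_intCast, Int.ceil_eq_iff]
  have a1 := Int.floor_le ((m:ℝ) * r)
  have a2 := Int.lt_floor_add_one ((m:ℝ) * r)
  have a3 : (⌊(m:ℝ) * r⌋:ℝ) ≠ m * r := by
    intro hc
    have hq : ((m:ℚ)) * r = (⌊(m:ℝ) * r⌋ : ℤ) := by exact_mod_cast hc.symm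
    have hz : (m:ℤ) * r.num = ⌊(m:ℝ) * r⌋ * r.den := by
      have h3 := Rat.den_mul_eq_num r
      have : (m:ℚ) * r.num = (⌊(m:ℝ) * r⌋ : ℤ) * r.den := by rw [← h3, ← hq]; ring
      exact_mod_cast this
    have hd : (r.den:ℤ) ∣ m * r.num := ⟨⌊(m:ℝ) * r⌋, by rw [hz, mul_comm]⟩
    have hco : IsCoprime (r.den:ℤ) r.num := by
      rw [Int.isCoprime_iff_gcd_eq_one, Int.gcd]
      simpa [Nat.coprime_comm] using r.reduced.symm
    have hd2 := hco.dvd_of_dvd_mul_right hd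
    have hd3 : r.den ∣ m := by exact_mod_cast hd2
    have := Nat.le_of_dvd (by omega) hd3
    omega
  have := lt_of_le_of_ne a1 a3
  push_cast
  constructor <;> linarith

lemma den_ge_two {r : ℚ} (h0 : 0 < r) (h1 : r < 1) : 2 ≤ r.den := by
  by_contra hc
  have hd : r.den = 1 := by have := r.den_pos; omega
  have h3 := Rat.den_mul_eq_num r
  rw [hd] at h3
  simp at h3
  rw [h3] at h0 h1
  have a : (0:ℤ) < r.num := by exact_mod_cast h0
  have b : r.num < (1:ℤ) := by exact_mod_cast h1
  omega

lemma piMap_st {r : ℚ} (h0 : 0 < r) (h1 : r < 1) :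
    piMap (cat (wrd (Fs r) r.den) (per (wrd (Ft r) r.den))) = Bv r - 1/4 := by
  have g0 : (0:ℝ) < r := by exact_mod_cast h0
  have g1 : (r:ℝ) < 1 := by exact_mod_cast h1
  have hden := den_ge_two h0 h1
  rw [← piMap_t h0 h1]
  have hF0 := Ft_zero g0 g1
  have hF0' := Fs_zero g0 g1
  have hF1 : Ft r 1 = 1 := by simp [Ft]
  have hF1' : Fs r 1 = 0 := by simp [Fs]
  have hF2 : Ft r 2 = 1 := by
    unfold Ft; rw [Int.floor_eq_iff]; push_cast; constructor <;> linarith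
  have hF2' : Fs r 2 = 1 := by
    unfold Fs; rw [Int.ceil_eq_iff]; push_cast; constructor <;> linarith
  have hP := per_wrd (Ft r) _ r.den_pos _ (Ft_per r)
  have hC : ∀ n < r.den, cat (wrd (Fs r) r.den) (per (wrd (Ft r) r.den)) n =
      decide (Fs r (n+1) = Fs r n + 1) := by
    intro n hn
    unfold cat
    rw [wrd_length, if_pos hn]
    simp [wrd, List.getD, hn]
  apply piMap_diff
  · rw [hP, hF0, zero_add, hF1]; rfl
  · rw [hP, hF1, hF2]; rfl
  · rw [hC 0 (by omega), hF0', zero_add, hF1']; rfl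
  · rw [hC 1 (by omega), hF1', hF2']; rfl
  · intro n
    rcases Nat.lt_or_ge (n+2) r.den with hn | hn
    · rw [hC _ hn, hP, Fs_Ft h1 _ (by omega) (by omega), Fs_Ft h1 _ (by omega) (by omega)]
    · unfold cat
      rw [wrd_length, if_neg (by omega), hP, hP]
      obtain ⟨m, hm⟩ : ∃ m, n + 2 = m + r.den := ⟨n + 2 - r.den, by omega⟩
      rw [hm, Nat.add_sub_cancel]
      have e : m + r.den + 1 = (m+1) + r.den := by ring
      rw [e, Ft_per, Ft_per]
      congr 1
      apply propext
      constructor <;> intro h <;> linarith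

lemma DeltaI_eq {r : ℚ} (h0 : 0 < r) (h1 : r < 1) :
    DeltaI [r] = Set.Icc (Av r) (Bv r - 1/4) := by
  have hs : sWord [r] = wrd (Fs r) r.den := by
    simp [sWord, substR, omegaMinus_eq (isMinus h0 h1)]
  have ht : tWord [r] = wrd (Ft r) r.den := by
    simp [tWord, substR, omegaPlus_eq (isPlus h0 h1)]
  unfold DeltaI
  rw [hs, ht, piMap_s h0 h1, piMap_st h0 h1]

lemma scal_cases (a : ℝ) (ha : a ∈ Set.Ioo (1/4 : ℝ) (1/2)) :
    (a ∈ Scal → ∃ g : ℝ, 0 < g ∧ g < 1 ∧ Irrational g ∧ a = Bv g - 1/4) ∧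
    (a ∉ Scal → ∃ r : ℚ, 0 < r ∧ r < 1 ∧ Av r ≤ a ∧ a ≤ Bv r - 1/4) := by
  constructor
  · rintro ⟨_, hn⟩
    obtain ⟨g, g0, g1, hA, hB⟩ := exists_gamma a ha.1 ha.2
    have hirr : Irrational g := by
      rintro ⟨r, rfl⟩
      have h0 : 0 < r := by exact_mod_cast g0
      have h1 : r < 1 := by exact_mod_cast g1
      apply hn
      simp only [Set.mem_iUnion]
      refine ⟨r, ⟨h0, h1⟩, ?_⟩
      rw [DeltaI_eq h0 h1]; exact ⟨hA, hB⟩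
    refine ⟨g, g0, g1, hirr, le_antisymm hB ?_⟩
    rw [← Av_irr g g0 g1 hirr]; exact hA
  · intro hn
    have : a ∈ ⋃ r ∈ {r : ℚ | 0 < r ∧ r < 1}, DeltaI [r] := by
      by_contra hc; exact hn ⟨ha, hc⟩
    simp only [Set.mem_iUnion] at this
    obtain ⟨r, ⟨h0, h1⟩, hr⟩ := this
    rw [DeltaI_eq h0 h1] at hr
    exact ⟨r, h0, h1, hr.1, hr.2⟩

lemma scal_val (a : ℝ) (ha : a ∈ Set.Ioo (1/4 : ℝ) (1/2)) (hS : a ∈ Scal) :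
    phi a = a + 1/4 ∧ chi a = a + 1/4 := by
  obtain ⟨g, g0, g1, hirr, rfl⟩ := (scal_cases a ha).1 hS
  have hA := Av_irr g g0 g1 hirr
  have hunc := J_uncountable (Bv g - 1/4) (Bv g) g g0 g1 hirr hA.le le_rfl
  have htriv : ∀ b, b < 1 → Bv g < b → J (Bv g - 1/4) b = ({0, 1} : Set ℝ) := fun b hb1 hb =>
    J_trivial _ b g g0 g1 ha.2 (by linarith [ha.1]) hb1 le_rfl hb
  have hmem : Bv g ∈ Set.Ioo (Bv g - 1/4) 1 := ⟨by linarith, Bv_lt g g0 g1⟩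
  have hfin : ({0, 1} : Set ℝ).Countable := (Set.toFinite _).countable
  rw [sub_add_cancel]
  constructor
  · refine IsGreatest.csSup_eq ⟨⟨hmem, fun h => hunc (h ▸ hfin)⟩, ?_⟩
    rintro b ⟨hb, hJ⟩
    by_contra hc
    exact hJ (htriv b hb.2 (not_le.1 hc))
  · refine IsGreatest.csSup_eq ⟨⟨hmem, hunc⟩, ?_⟩
    rintro b ⟨hb, hJ⟩
    by_contra hc
    exact hJ (by rw [htriv b hb.2 (not_le.1 hc)]; exact hfin)

lemma not_scal (a : ℝ) (ha : a ∈ Set.Ioo (1/4 : ℝ) (1/2)) (hS : a ∉ Scal) : chi a < phi a := by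
  obtain ⟨r, h0, h1, hA, hB⟩ := (scal_cases a ha).2 hS
  have g0 : (0:ℝ) < r := by exact_mod_cast h0
  have g1 : (r:ℝ) < 1 := by exact_mod_cast h1
  have hphi : Bv r ≤ phi a := by
    refine le_csSup ⟨1, fun b hb => hb.1.2.le⟩ ⟨⟨by linarith, Bv_lt _ g0 g1⟩, ?_⟩
    exact J_ne a _ r g0 g1 hA le_rfl
  have hpos : 0 < (1/2 - a) / 2^r.den := div_pos (by linarith [ha.2]) (by positivity)
  have hchi : chi a ≤ max (1/2) (Bv r - (1/2 - a) / 2^r.den) := by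
    refine Real.sSup_le ?_ (le_max_of_le_left (by norm_num))
    rintro b ⟨hb, hJ⟩
    by_contra hc
    rw [not_le, max_lt_iff] at hc
    exact hJ (J_countable a b r g0 g1 r.den_pos den_mul ha.2 hc.1 hB hc.2)
  refine lt_of_le_of_lt hchi (lt_of_lt_of_le ?_ hphi)
  exact max_lt (Bv_gt _ g0 g1) (by linarith)


theorem stmt13 (a : ℝ) (ha : a ∈ Set.Ioo (1/4 : ℝ) (1/2)) :
    (phi a = chi a ↔ a ∈ Scal) ∧
    (a ∈ Scal → phi a = a + 1/4 ∧ chi a = a + 1/4) := by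
  refine ⟨⟨fun h => ?_, fun h => ?_⟩, scal_val a ha⟩
  · by_contra hS
    exact absurd h.symm (not_scal a ha hS).ne
  · rw [(scal_val a ha h).1, (scal_val a ha h).2]

end
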